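/- Suppose that A and the Yoneda ring Y(e) both have finite global dimension. Then Γ := (1-e)A(1-e) has finite global dimension. -/

import Mathlib

set_option linter.unusedVariables false
set_option maxHeartbeats 1000000

/-! Common setup: corner rings, the simple module `S_e`, Ext-algebras (Yoneda rings),
semiperfect and basic rings, finite global dimension. -/

open CategoryTheory CategoryTheory.Abelian
open scoped DirectSum

noncomputable section

/-- Smallness of Ext groups for module categories. -/
instance hasExtModuleCat (R : Type u) [Ring R] : HasExt.{u + 1} (ModuleCat.{u} R) :=
  letI := HasDerivedCategory.standard (ModuleCat.{u} R)
  hasExt_of_hasDerivedCategory _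

/-! ### Corner rings `eAe` -/

/-- The corner ring `eAe = {x : A | e * x = x ∧ x * e = x}` of an idempotent `e : A`. -/
def CornerRing {A : Type*} [Ring A] (e : A) (_ : IsIdempotentElem e) : Type _ :=
  {x : A // e * x = x ∧ x * e = x}

namespace CornerRing

variable {A : Type*} [Ring A] {e : A} {he : IsIdempotentElem e}

instance : Zero (CornerRing e he) := ⟨⟨0, by simp, by simp⟩⟩
instance : One (CornerRing e he) := ⟨⟨e, he, he⟩⟩
instance : Add (CornerRing e he) :=
  ⟨fun x y => ⟨x.1 + y.1, by rw [mul_add, x.2.1, y.2.1], by rw [add_mul, x.2.2, y.2.2]⟩⟩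
instance : Neg (CornerRing e he) :=
  ⟨fun x => ⟨-x.1, by rw [mul_neg, x.2.1], by rw [neg_mul, x.2.2]⟩⟩
instance : Mul (CornerRing e he) :=
  ⟨fun x y => ⟨x.1 * y.1, by rw [← mul_assoc, x.2.1], by rw [mul_assoc, y.2.2]⟩⟩

instance instRing : Ring (CornerRing e he) where
  add_assoc x y z := Subtype.ext (add_assoc _ _ _)
  zero_add x := Subtype.ext (zero_add _)
  add_zero x := Subtype.ext (add_zero _)
  add_comm x y := Subtype.ext (add_comm _ _)
  neg_add_cancel x := Subtype.ext (neg_add_cancel _)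
  mul_assoc x y z := Subtype.ext (mul_assoc _ _ _)
  one_mul x := Subtype.ext x.2.1
  mul_one x := Subtype.ext x.2.2
  left_distrib x y z := Subtype.ext (left_distrib _ _ _)
  right_distrib x y z := Subtype.ext (right_distrib _ _ _)
  zero_mul x := Subtype.ext (zero_mul _)
  mul_zero x := Subtype.ext (mul_zero _)
  nsmul := nsmulRec
  zsmul := zsmulRec

end CornerRing

/-! ### The semisimple module `S_e = eA / e rad A` -/

/-- The Jacobson radical of the ring `A`, as a set. -/
def ringRadical (A : Type*) [Ring A] : Set A :=
  ((⊥ : TwoSidedIdeal A).jacobson : Set A)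

/-- The right ideal `eA`, as a right `A`-module (i.e. an `Aᵐᵒᵖ`-module). -/
def rightIdeal (A : Type*) [Ring A] (e : A) : Submodule Aᵐᵒᵖ A :=
  Submodule.span Aᵐᵒᵖ {e}

/-- The right submodule `e (rad A)` of `A`. -/
def eRad (A : Type*) [Ring A] (e : A) : Submodule Aᵐᵒᵖ A :=
  Submodule.span Aᵐᵒᵖ ((e * ·) '' ringRadical A)

/-- The semisimple right `A`-module `S_e = eA / e rad A` associated with an idempotent `e`. -/
def SeModule (A : Type*) [Ring A] (e : A) : Type _ :=
  rightIdeal A e ⧸ (eRad A e).comap (rightIdeal A e).subtype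

instance (A : Type*) [Ring A] (e : A) : AddCommGroup (SeModule A e) :=
  inferInstanceAs (AddCommGroup (rightIdeal A e ⧸ (eRad A e).comap (rightIdeal A e).subtype))

instance (A : Type*) [Ring A] (e : A) : Module Aᵐᵒᵖ (SeModule A e) :=
  inferInstanceAs (Module Aᵐᵒᵖ (rightIdeal A e ⧸ (eRad A e).comap (rightIdeal A e).subtype))

/-- `S_e` as an object of the category of right `A`-modules. -/
def Se (A : Type) [Ring A] (e : A) : ModuleCat Aᵐᵒᵖ :=
  ModuleCat.of Aᵐᵒᵖ (SeModule A e)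

/-! ### The Ext-algebra (Yoneda ring) of an object of an abelian category -/

namespace ExtYoneda

universe w v u
variable {C : Type u} [Category.{v} C] [Abelian C] [HasExt.{w} C]

lemma comp_heq {X Y Z : C} {a b c : ℕ} (h : a + b = c) (α : Ext X Y a) (β : Ext Y Z b) :
    HEq (α.comp β rfl) (α.comp β h) := by subst h; rfl

variable (X : C)

def gmul : GradedMonoid.GMul (fun i : ℕ => Ext X X i) where
  mul {i j} α β := α.comp β rfl

def gone : GradedMonoid.GOne (fun i : ℕ => Ext X X i) where
  one := Ext.mk₀ (𝟙 X)

def gmonoid : GradedMonoid.GMonoid (fun i : ℕ => Ext X X i) :=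
  letI := gmul X
  letI := gone X
  { one_mul := fun a => by
      obtain ⟨i, α⟩ := a
      exact Sigma.ext (zero_add i)
        ((comp_heq (zero_add i) _ _).trans (heq_of_eq (Ext.mk₀_id_comp α)))
    mul_one := fun a => by
      obtain ⟨i, α⟩ := a
      exact Sigma.ext (add_zero i)
        ((comp_heq (add_zero i) _ _).trans (heq_of_eq (Ext.comp_mk₀_id α)))
    mul_assoc := fun a b c => by
      obtain ⟨i, α⟩ := a
      obtain ⟨j, β⟩ := b
      obtain ⟨k, γ⟩ := c
      refine Sigma.ext (add_assoc i j k) ?_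
      refine (heq_of_eq (Ext.comp_assoc α β γ rfl rfl rfl)).trans ?_
      exact (comp_heq (h := (add_assoc i j k).symm ▸ rfl) _ _).symm }

/-- The graded ring structure on `fun i => Ext X X i` given by the Yoneda product. -/
def gring : DirectSum.GRing (fun i : ℕ => Ext X X i) :=
  letI := gmonoid X
  { __ := gmonoid X
    mul_zero := fun {i j} α => Ext.comp_zero α _ _ _ rfl
    zero_mul := fun {i j} β => Ext.zero_comp _ _ β _ rfl
    mul_add := fun {_ _} α β γ => Ext.comp_add _ _ _ rfl
    add_mul := fun {_ _} α β γ => Ext.add_comp _ _ _ rfl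
    natCast := fun n => n • Ext.mk₀ (𝟙 X)
    natCast_zero := zero_smul _ _
    natCast_succ := fun n => succ_nsmul _ _
    intCast := fun z => z • Ext.mk₀ (𝟙 X)
    intCast_ofNat := fun n => natCast_zsmul _ _
    intCast_negSucc_ofNat := fun n => negSucc_zsmul _ _ }

end ExtYoneda

/-- The Yoneda (Ext-) ring `⨁ i, Ext X X i` of an object `X` of an abelian category,
with multiplication induced by the Yoneda product. -/
def ExtRing {C : Type u} [Category.{v} C] [Abelian C] [HasExt.{w} C] (X : C) : Type w :=
  ⨁ i : ℕ, Ext X X i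

instance {C : Type u} [Category.{v} C] [Abelian C] [HasExt.{w} C] (X : C) :
    Ring (ExtRing X) :=
  letI := ExtYoneda.gring X
  inferInstanceAs (Ring (⨁ i : ℕ, Ext X X i))

/-- The Yoneda ring `Y(e) = Ext_A^*(S_e, S_e)` of an idempotent `e` of the ring `A`. -/
def YonedaRing (A : Type) [Ring A] (e : A) : Type 1 :=
  ExtRing (Se A e)

instance (A : Type) [Ring A] (e : A) : Ring (YonedaRing A e) :=
  inferInstanceAs (Ring (ExtRing (Se A e)))

/-! ### Homological and ring-theoretic conditions -/

/-- A ring `R` has finite (right) global dimension if there is a uniform bound `n` such that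
`Ext^i(M, N)` vanishes for all right `R`-modules `M`, `N` and all `i > n`. -/
def HasFiniteGlobalDimension (R : Type u) [Ring R] : Prop :=
  ∃ n : ℕ, ∀ (M N : ModuleCat.{u} Rᵐᵒᵖ) (i : ℕ), n < i → Subsingleton (Ext M N i)

/-- A ring is Artinian on both sides. -/
def IsTwoSidedArtinian (R : Type u) [Ring R] : Prop :=
  IsArtinianRing R ∧ IsArtinianRing Rᵐᵒᵖ

/-- A ring is Noetherian on both sides. -/
def IsTwoSidedNoetherian (R : Type u) [Ring R] : Prop :=
  IsNoetherianRing R ∧ IsNoetherianRing Rᵐᵒᵖ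

/-- A ring is semiperfect iff `1` decomposes as a finite sum of pairwise orthogonal
idempotents each of whose corner rings is local. -/
def IsSemiperfectRing (A : Type*) [Ring A] : Prop :=
  ∃ (n : ℕ) (f : Fin n → A) (hf : ∀ i, IsIdempotentElem (f i)),
    (∀ i j, i ≠ j → f i * f j = 0) ∧ (∑ i, f i = 1) ∧
      ∀ i, IsLocalRing (CornerRing (f i) (hf i))

/-- An idempotent is primitive if it is nonzero and cannot be written as the sum of two
nonzero orthogonal idempotents. -/
def IsPrimitiveIdempotent {A : Type*} [Ring A] (e : A) : Prop :=
  IsIdempotentElem e ∧ e ≠ 0 ∧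
    ∀ f g : A, IsIdempotentElem f → IsIdempotentElem g → f * g = 0 → g * f = 0 →
      f + g = e → f = 0 ∨ g = 0

/-- A ring is basic if `1` decomposes as a finite sum of pairwise orthogonal primitive
idempotents whose associated indecomposable projective right modules are pairwise
non-isomorphic. -/
def IsBasicRing (A : Type*) [Ring A] : Prop :=
  ∃ (n : ℕ) (f : Fin n → A),
    (∀ i, IsPrimitiveIdempotent (f i)) ∧ (∀ i j, i ≠ j → f i * f j = 0) ∧ (∑ i, f i = 1) ∧
      ∀ i j, i ≠ j → IsEmpty ((rightIdeal A (f i)) ≃ₗ[Aᵐᵒᵖ] (rightIdeal A (f j)))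

end

section
open CategoryTheory CategoryTheory.Abelian Limits
open scoped DirectSum ZeroObject
set_option linter.unusedSectionVars false
set_option linter.unusedVariables false

noncomputable section
namespace YT

universe w v u
variable {C : Type u} [Category.{v} C] [Abelian C] [HasExt.{w} C] [HasDerivedCategory.{w} C]

/-- The object `M` viewed in the derived category. -/
abbrev sg (M : C) : DerivedCategory C := (DerivedCategory.singleFunctor C 0).obj M

/-- The total graded morphism group from `X` to shifts of `M`. -/
def Hmod (M : C) (X : DerivedCategory C) : Type w :=
  ∀ i : ℤ, ShiftedHom X (sg M) i

variable (M : C)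

instance (X : DerivedCategory C) : AddCommGroup (Hmod M X) :=
  inferInstanceAs (AddCommGroup (∀ i : ℤ, ShiftedHom X (sg M) i))

variable {M}

@[simp] lemma Hmod.add_apply {X : DerivedCategory C} (h k : Hmod M X) (i : ℤ) :
    (h + k) i = h i + k i := rfl
@[simp] lemma Hmod.zero_apply {X : DerivedCategory C} (i : ℤ) :
    (0 : Hmod M X) i = 0 := rfl

@[ext] lemma Hmod.ext {X : DerivedCategory C} {h k : Hmod M X} (H : ∀ i, h i = k i) : h = k :=
  funext H

lemma comp_congr {X : DerivedCategory C} (h : Hmod M X) {a a' b c : ℤ} (e : a = a')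
    (g : ShiftedHom (sg M) (sg M) b) (h1 : b + a = c) (h2 : b + a' = c) :
    (h a).comp g h1 = (h a').comp g h2 := by subst e; rfl

/-- Action of a homogeneous element. -/
def actHom {X : DerivedCategory C} (h : Hmod M X) (n : ℕ) : Ext M M n →+ Hmod M X where
  toFun α := fun i => (h (i - n)).comp α.hom (by lia)
  map_zero' := by
    ext i
    show (h (i - n)).comp (Ext.hom 0) _ = 0
    simp
  map_add' α β := by
    ext i
    have e : Ext.hom (α + β) = Ext.hom α + Ext.hom β := by simp
    have hh : (n : ℤ) + (i - n) = i := by lia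
    show (h (i - n)).comp (Ext.hom (α + β)) hh = (h (i - n)).comp (Ext.hom α) hh +
      (h (i - n)).comp (Ext.hom β) hh
    rw [e, ShiftedHom.comp_add]

lemma actHom_apply {X : DerivedCategory C} (h : Hmod M X) (n : ℕ) (α : Ext M M n) (i : ℤ) :
    actHom h n α i = (h (i - n)).comp α.hom (by lia) := rfl

/-- Homogeneous elements of the Ext ring. -/
def eof (n : ℕ) : Ext M M n →+ ExtRing M := DirectSum.of (fun i : ℕ => Ext M M i) n

lemma ext_ind {p : ExtRing M → Prop} (y : ExtRing M) (h0 : p 0) (h1 : ∀ n α, p (eof n α))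
    (h2 : ∀ a b, p a → p b → p (a + b)) : p y :=
  DirectSum.induction_on (motive := p) y h0 h1 h2

lemma eof_mul (i j : ℕ) (α : Ext M M i) (β : Ext M M j) :
    eof i α * eof j β = eof (i + j) (α.comp β rfl) := by
  letI := ExtYoneda.gring M
  exact DirectSum.of_mul_of (A := fun i : ℕ => Ext M M i) α β

lemma eof_one : (1 : ExtRing M) = eof 0 (Ext.mk₀ (𝟙 M)) := rfl

/-- The right action. -/
def act {X : DerivedCategory C} (h : Hmod M X) : ExtRing M →+ Hmod M X :=
  DirectSum.toAddMonoid (fun n => actHom h n)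

@[simp] lemma act_eof {X : DerivedCategory C} (h : Hmod M X) (n : ℕ) (α : Ext M M n) :
    act h (eof n α) = actHom h n α :=
  DirectSum.toAddMonoid_of _ _ _

lemma act_add {X : DerivedCategory C} (h k : Hmod M X) (y : ExtRing M) :
    act (h + k) y = act h y + act k y := by
  induction y using ext_ind with
  | h0 => simp
  | h1 n α => ext i; simp [actHom_apply]
  | h2 a b ha hb => simp only [map_add, ha, hb]; abel

lemma act_zero {X : DerivedCategory C} (y : ExtRing M) :
    act (0 : Hmod M X) y = 0 := by
  have := act_add (0 : Hmod M X) 0 y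
  simpa using this

lemma act_one {X : DerivedCategory C} (h : Hmod M X) : act h 1 = h := by
  rw [eof_one, act_eof]
  ext i
  rw [actHom_apply, comp_congr h (show i - ((0 : ℕ) : ℤ) = i by simp) _ _ (by simp)]
  rw [Ext.mk₀_hom, CategoryTheory.Functor.map_id, ShiftedHom.comp_mk₀_id]

lemma act_mul {X : DerivedCategory C} (h : Hmod M X) (y z : ExtRing M) :
    act h (y * z) = act (act h y) z := by
  induction y using ext_ind with
  | h0 => simp [act_zero]
  | h2 a b ha hb => rw [add_mul, map_add, ha, hb, map_add, act_add]
  | h1 n α =>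
    induction z using ext_ind with
    | h0 => simp
    | h2 a b ha hb => rw [mul_add, map_add, ha, hb, map_add]
    | h1 m β =>
      rw [eof_mul, act_eof, act_eof, act_eof]
      ext i
      rw [actHom_apply, actHom_apply, actHom_apply, Ext.comp_hom,
        ← ShiftedHom.comp_assoc (h (i - (n + m : ℕ))) α.hom β.hom (a₁₂ := i - m)
          (by push_cast; lia) (by push_cast; lia) (by push_cast; lia)]
      congr 1
      exact comp_congr h (by push_cast; lia) _ _ _

instance (X : DerivedCategory C) : Module (ExtRing M)ᵐᵒᵖ (Hmod M X) where
  smul y h := act h y.unop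
  one_smul h := act_one h
  mul_smul y z h := act_mul h z.unop y.unop
  smul_zero y := act_zero _
  smul_add y h k := act_add _ _ _
  add_smul y z h := map_add _ _ _
  zero_smul h := map_zero _

lemma smul_def' {X : DerivedCategory C} (y : (ExtRing M)ᵐᵒᵖ) (h : Hmod M X) :
    y • h = act h y.unop := rfl

/-- Precomposition. -/
def pre {X X' : DerivedCategory C} (u : X ⟶ X') (h : Hmod M X') : Hmod M X := fun i => u ≫ h i

lemma pre_apply {X X' : DerivedCategory C} (u : X ⟶ X') (h : Hmod M X') (i : ℤ) :
    pre u h i = u ≫ h i := rfl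

lemma pre_add {X X' : DerivedCategory C} (u : X ⟶ X') (h k : Hmod M X') :
    pre u (h + k) = pre u h + pre u k := by
  refine Hmod.ext fun i => ?_
  exact Preadditive.comp_add _ _ _ _ _ _

lemma pre_act {X X' : DerivedCategory C} (u : X ⟶ X') (h : Hmod M X') (y : ExtRing M) :
    pre u (act h y) = act (pre u h) y := by
  induction y using ext_ind with
  | h0 => simp only [map_zero]; refine Hmod.ext fun i => ?_; exact comp_zero
  | h1 n α =>
    refine Hmod.ext fun i => ?_
    rw [act_eof, act_eof, pre_apply, actHom_apply, actHom_apply]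
    simp [ShiftedHom.comp, pre_apply]
  | h2 a b ha hb => rw [map_add, map_add, ← ha, ← hb, pre_add]

/-- Precomposition as a linear map. -/
def Hmap {X X' : DerivedCategory C} (u : X ⟶ X') :
    Hmod M X' →ₗ[(ExtRing M)ᵐᵒᵖ] Hmod M X where
  toFun h := pre u h
  map_add' h k := pre_add u h k
  map_smul' y h := pre_act u h y.unop

@[simp] lemma Hmap_apply {X X' : DerivedCategory C} (u : X ⟶ X') (h : Hmod M X') (i : ℤ) :
    Hmap u h i = u ≫ h i := rfl

/-- A homogeneous element. -/
def hs {X : DerivedCategory C} (i : ℤ) (h : X ⟶ (sg M)⟦i⟧) : Hmod M X :=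
  Pi.single (M := fun i : ℤ => ShiftedHom X (sg M) i) i h

@[simp] lemma hs_same {X : DerivedCategory C} (i : ℤ) (h : X ⟶ (sg M)⟦i⟧) : hs i h i = h :=
  Pi.single_eq_same _ _

lemma hs_ne {X : DerivedCategory C} {i j : ℤ} (hij : j ≠ i) (h : X ⟶ (sg M)⟦i⟧) :
    hs i h j = 0 :=
  Pi.single_eq_of_ne hij _

lemma Hmap_hs {X X' : DerivedCategory C} (u : X ⟶ X') (i : ℤ) (h : X' ⟶ (sg M)⟦i⟧) :
    Hmap u (hs i h) = hs i (u ≫ h) := by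
  ext j
  rw [Hmap_apply]
  by_cases hj : j = i
  · subst hj; simp
  · rw [hs_ne hj, hs_ne hj, comp_zero]

variable (M) in
/-- Objects that behave like finite sums of shifts of `M`. -/
structure Nice (F : DerivedCategory C) : Prop where
  proj : Module.Projective (ExtRing M)ᵐᵒᵖ (Hmod M F)
  real : ∀ (T : DerivedCategory C) (ρ : Hmod M F →ₗ[(ExtRing M)ᵐᵒᵖ] Hmod M T),
    ∃ v : T ⟶ F, ∀ (i : ℤ) (h : F ⟶ (sg M)⟦i⟧), ρ (hs i h) i = v ≫ h

lemma Nice.zero : Nice M (0 : DerivedCategory C) where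
  proj := by
    have : Subsingleton (Hmod M (0 : DerivedCategory C)) :=
      ⟨fun a b => by refine Hmod.ext fun i => ?_; exact (isZero_zero _).eq_of_src _ _⟩
    infer_instance
  real T ρ := ⟨0, fun i h => by
    have : h = 0 := (isZero_zero _).eq_of_src _ _
    subst this
    have : hs i (0 : (0 : DerivedCategory C) ⟶ (sg M)⟦i⟧) = 0 := by
      refine Hmod.ext fun j => ?_; exact (isZero_zero _).eq_of_src _ _
    rw [this, map_zero, comp_zero]; rfl⟩

lemma Nice.biprod {F G : DerivedCategory C} (hF : Nice M F) (hG : Nice M G) :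
    Nice M (F ⊞ G) where
  proj := by
    let e : Hmod M (F ⊞ G) ≃ₗ[(ExtRing M)ᵐᵒᵖ] (Hmod M F × Hmod M G) :=
      LinearEquiv.ofLinearMap
        ((Hmap biprod.inl).prod (Hmap biprod.inr))
        ((Hmap biprod.fst).coprod (Hmap biprod.snd))
        (by
          refine LinearMap.ext fun x => ?_
          refine Prod.ext ?_ ?_ <;> refine Hmod.ext fun i => ?_ <;> simp)
        (by
          refine LinearMap.ext fun x => ?_
          refine Hmod.ext fun i => ?_
          apply biprod.hom_ext' <;> simp)
    have := hF.proj
    have := hG.proj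
    exact Module.Projective.of_equiv e.symm
  real T ρ := by
    obtain ⟨v, hv⟩ := hF.real T (ρ.comp (Hmap biprod.fst))
    obtain ⟨w, hw⟩ := hG.real T (ρ.comp (Hmap biprod.snd))
    refine ⟨biprod.lift v w, fun i h => ?_⟩
    have e : hs i h = Hmap biprod.fst (hs i (biprod.inl ≫ h)) +
        Hmap biprod.snd (hs i (biprod.inr ≫ h)) := by
      rw [Hmap_hs, Hmap_hs]
      refine Hmod.ext fun j => ?_
      by_cases hj : j = i
      · subst hj
        simp only [Hmod.add_apply, hs_same]
        apply biprod.hom_ext' <;> simp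
      · simp [hs_ne hj]
    have h1 := hv i (biprod.inl ≫ h)
    have h2 := hw i (biprod.inr ≫ h)
    rw [LinearMap.comp_apply] at h1 h2
    rw [e, map_add, Hmod.add_apply, h1, h2, biprod.lift_eq]
    simp

/-- the generator of the free module attached to a shift. -/
def gen (d : ℤ) : Hmod M ((sg M)⟦d⟧) := hs d (𝟙 _)

lemma act_gen_eof (d : ℤ) (n : ℕ) (α : Ext M M n) (i : ℤ) (hi : (n : ℤ) + d = i) :
    act (gen d) (eof n α) = hs (M := M) i (ShiftedHom.comp (𝟙 _) α.hom hi) := by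
  rw [act_eof]
  ext j
  rw [actHom_apply]
  by_cases hj : j = i
  · subst hj
    rw [hs_same, comp_congr (gen d) (show j - n = d by lia) α.hom _ hi]
    simp [gen]
  · rw [hs_ne hj, gen, hs_ne (by lia), ShiftedHom.zero_comp]

lemma exists_eof (d i : ℤ) (h : (sg M)⟦d⟧ ⟶ (sg M)⟦i⟧) :
    h = 0 ∨ ∃ (n : ℕ) (hi : (n : ℤ) + d = i) (α : Ext M M n),
      h = ShiftedHom.comp (𝟙 _) α.hom hi := by
  obtain ⟨g, hg⟩ := (shiftFunctor (DerivedCategory C) d).map_surjective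
    (h ≫ (shiftFunctorAdd' (DerivedCategory C) (i - d) d i (by lia)).hom.app (sg M))
  have hh : h = g⟦d⟧' ≫ (shiftFunctorAdd' (DerivedCategory C) (i - d) d i (by lia)).inv.app (sg M) := by
    rw [hg]; simp
  by_cases hid : i < d
  · left
    have : g = 0 := by
      have : ((sg M)⟦i - d⟧).IsGE (-(i-d)) := by
        exact DerivedCategory.TStructure.t.isGE_shift _ 0 _ _ (by lia)
      exact DerivedCategory.TStructure.t.zero g 0 (-(i-d)) (by lia)
    rw [hh, this]
    simp
  · right
    obtain ⟨n, hn⟩ := Int.eq_ofNat_of_zero_le (show 0 ≤ i - d by lia)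
    obtain rfl : i = n + d := by lia
    obtain ⟨α, hα⟩ : ∃ α : Ext M M n, α.hom = g ≫ eqToHom (by rw [hn]) :=
      Ext.homEquiv.surjective _
    refine ⟨n, rfl, α, ?_⟩
    rw [hh, hα]
    have key : ∀ (a b : ℤ) (hab : a = b) (h1 : a + d = n + d) (h2 : b + d = n + d)
      (g : sg M ⟶ (sg M)⟦a⟧),
        g⟦d⟧' ≫ (shiftFunctorAdd' (DerivedCategory C) a d (n + d) h1).inv.app (sg M) =
        ShiftedHom.comp (𝟙 ((sg M)⟦d⟧)) (g ≫ eqToHom (by rw [hab]) : ShiftedHom (sg M) (sg M) b) h2 := by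
      intro a b hab h1 h2 g
      subst hab
      simp [ShiftedHom.comp]
    exact key _ _ hn _ _ g

lemma shift_comp_inj (d : ℤ) (n : ℕ) (α : Ext M M n) (i : ℤ) (hi : (n : ℤ) + d = i)
    (h : ShiftedHom.comp (𝟙 ((sg M)⟦d⟧)) α.hom hi = 0) : α = 0 := by
  rw [ShiftedHom.comp, Category.id_comp] at h
  have h' : (α.hom)⟦d⟧' = 0 := by
    have := congrArg (· ≫ (shiftFunctorAdd' (DerivedCategory C) (n : ℤ) d i hi).hom.app (sg M)) h
    simpa using this
  have : α.hom = 0 := (shiftFunctor (DerivedCategory C) d).map_injective (by rw [h']; simp)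
  ext
  rw [this]; simp

lemma act_gen_apply (d : ℤ) (y : ExtRing M) (n : ℕ) (i : ℤ) (hi : (n : ℤ) + d = i) :
    act (gen d) y i = ShiftedHom.comp (𝟙 _) (Ext.hom ((show ⨁ i : ℕ, Ext M M i from y) n)) hi := by
  induction y using ext_ind with
  | h0 =>
    rw [map_zero]
    show 0 = ShiftedHom.comp _ (Ext.hom 0) _
    simp
  | h1 m α =>
    by_cases hm : m = n
    · subst hm
      rw [act_gen_eof d m α i hi, hs_same]
      congr 2
      exact (DirectSum.of_eq_same (β := fun i : ℕ => Ext M M i) m α).symm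
    · rw [act_gen_eof d m α _ rfl, hs_ne (by lia)]
      have : (show ⨁ i : ℕ, Ext M M i from eof m α) n = 0 :=
        DirectSum.of_eq_of_ne (β := fun i : ℕ => Ext M M i) m n α (Ne.symm hm)
      rw [this]
      simp
  | h2 a b ha hb =>
    rw [map_add, Hmod.add_apply, ha, hb]
    have : (show ⨁ i : ℕ, Ext M M i from (a + b : ExtRing M)) n =
      (show ⨁ i : ℕ, Ext M M i from a) n + (show ⨁ i : ℕ, Ext M M i from b) n := rfl
    rw [this]
    simp

lemma Nice.shift (N : ℕ) (hN : ∀ n, N ≤ n → Subsingleton (Ext M M n)) (d : ℤ) :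
    Nice M ((sg M)⟦d⟧) where
  proj := by
    let φ : (ExtRing M)ᵐᵒᵖ →ₗ[(ExtRing M)ᵐᵒᵖ] Hmod M ((sg M)⟦d⟧) :=
      LinearMap.toSpanSingleton _ _ (gen d)
    have hφ : ∀ y, φ y = act (gen d) y.unop := fun y => rfl
    have inj : Function.Injective φ := by
      rw [injective_iff_map_eq_zero]
      intro y hy
      rw [hφ] at hy
      apply MulOpposite.unop_injective
      rw [MulOpposite.unop_zero]
      refine DFinsupp.ext (fun n => ?_)
      have := congrFun hy (n + d)
      rw [act_gen_apply d y.unop n _ rfl] at this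
      exact shift_comp_inj d n _ _ rfl this
    have surj : Function.Surjective φ := by
      intro h
      have H : ∀ n : ℕ, ∃ α : Ext M M n, h (n + d) = ShiftedHom.comp (𝟙 _) α.hom rfl := by
        intro n
        obtain h0 | ⟨m, hm, α, hα⟩ := exists_eof d (n + d) (h (n + d))
        · exact ⟨0, by rw [h0]; simp⟩
        · obtain rfl : m = n := by lia
          exact ⟨α, hα⟩
      choose α hα using H
      refine ⟨MulOpposite.op (∑ n ∈ Finset.range N, eof n (α n)), ?_⟩
      rw [hφ, MulOpposite.unop_op, map_sum]
      ext i
      have e1 : ∀ (s : Finset ℕ), (∑ n ∈ s, act (gen d) (eof n (α n)) : Hmod M ((sg M)⟦d⟧)) i =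
        ∑ n ∈ s, act (gen d) (eof n (α n)) i := fun s =>
          Finset.sum_apply (M := fun i : ℤ => ShiftedHom ((sg M)⟦d⟧) (sg M) i) i s _
      rw [e1]
      by_cases hid : i < d
      · have : h i = 0 := by
          obtain h0 | ⟨m, hm, _⟩ := exists_eof d i (h i)
          · exact h0
          · lia
        rw [this]
        refine Finset.sum_eq_zero (fun n _ => ?_)
        rw [act_gen_eof d n _ _ rfl, hs_ne (by lia)]
      · obtain ⟨n, hn⟩ := Int.eq_ofNat_of_zero_le (show 0 ≤ i - d by lia)
        obtain rfl : i = n + d := by lia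
        rw [Finset.sum_eq_single n]
        · rw [act_gen_eof d n _ _ rfl, hs_same, hα]
        · intro b _ hb
          rw [act_gen_eof d b _ _ rfl, hs_ne (by lia)]
        · intro hn
          have := hN n (by simpa using hn)
          rw [Subsingleton.elim (α n) 0]
          simp
    exact Module.Projective.of_equiv (LinearEquiv.ofBijective φ ⟨inj, surj⟩)
  real T ρ := by
    refine ⟨ρ (gen d) d, fun i h => ?_⟩
    obtain h0 | ⟨n, hi, α, hα⟩ := exists_eof d i h
    · subst h0
      have : hs i (0 : (sg M)⟦d⟧ ⟶ (sg M)⟦i⟧) = 0 := Pi.single_zero _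
      rw [this, map_zero, comp_zero]; rfl
    · have e : hs i h = MulOpposite.op (eof n α) • gen d := by
        rw [smul_def', MulOpposite.unop_op, act_gen_eof d n α i hi, hα]
      rw [e, map_smul, smul_def', MulOpposite.unop_op, act_eof, actHom_apply, hα]
      rw [comp_congr _ (show i - n = d by lia) _ _ hi]
      simp [ShiftedHom.comp]

end YT
end
end


section
open CategoryTheory CategoryTheory.Abelian Limits Pretriangulated
open scoped DirectSum ZeroObject
set_option linter.unusedSectionVars false
set_option linter.unusedVariables false

noncomputable section
namespace YT

section Ev
universe v u u'
variable {T : Type u} [Category.{v} T] [HasZeroObject T] [HasShift T ℤ] [Preadditive T]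
  [∀ n : ℤ, (shiftFunctor T n).Additive] [Pretriangulated T] {ι : Type u'}

/-- eventually left orthogonal to all members of a family. -/
def Ev (fam : ι → T) (X : T) : Prop :=
  ∃ n : ℤ, ∀ (j : ι) (i : ℤ), n ≤ i → ∀ f : X ⟶ (fam j)⟦i⟧, f = 0

variable {fam : ι → T}

lemma Ev.retract {X Y : T} (h : Ev fam X) (r : Y ⟶ X) (s : X ⟶ Y) (hrs : r ≫ s = 𝟙 Y) :
    Ev fam Y := by
  obtain ⟨n, hn⟩ := h
  refine ⟨n, fun j i hi f => ?_⟩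
  rw [← Category.id_comp f, ← hrs, Category.assoc, hn j i hi (s ≫ f), comp_zero]

lemma Ev.iso {X Y : T} (h : Ev fam X) (e : X ≅ Y) : Ev fam Y :=
  h.retract e.inv e.hom (by simp)

lemma Ev.zero {X : T} (h : IsZero X) : Ev fam X := ⟨0, fun _ _ _ _ => h.eq_of_src _ _⟩

lemma Ev.shift {X : T} (h : Ev fam X) (d : ℤ) : Ev fam (X⟦d⟧) := by
  obtain ⟨n, hn⟩ := h
  refine ⟨n + d, fun j i hi f => ?_⟩
  obtain ⟨g, hg⟩ := (shiftFunctor T d).map_surjective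
    (f ≫ (shiftFunctorAdd' T (i - d) d i (by lia)).hom.app (fam j))
  rw [hn j (i - d) (by lia) g, Functor.map_zero] at hg
  have := congrArg (· ≫ (shiftFunctorAdd' T (i - d) d i (by lia)).inv.app (fam j)) hg
  simpa using this.symm

lemma Ev.tri₂ {t : Triangle T} (ht : t ∈ distTriang T) (h1 : Ev fam t.obj₁)
    (h3 : Ev fam t.obj₃) : Ev fam t.obj₂ := by
  obtain ⟨n, hn⟩ := h1
  obtain ⟨m, hm⟩ := h3
  refine ⟨max n m, fun j i hi f => ?_⟩
  obtain ⟨g, rfl⟩ := Triangle.yoneda_exact₂ t ht f (hn j i (by lia) _)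
  rw [hm j i (by lia) g, comp_zero]

lemma Ev.tri₁ {t : Triangle T} (ht : t ∈ distTriang T) (h2 : Ev fam t.obj₂)
    (h3 : Ev fam t.obj₃) : Ev fam t.obj₁ :=
  Ev.tri₂ (inv_rot_of_distTriang _ ht) (h3.shift (-1)) h2

lemma Ev.tri₃ {t : Triangle T} (ht : t ∈ distTriang T) (h1 : Ev fam t.obj₁)
    (h2 : Ev fam t.obj₂) : Ev fam t.obj₃ :=
  Ev.tri₂ (rot_of_distTriang _ ht) h2 (h1.shift 1)

lemma Ev.biprod {X Y : T} (hX : Ev fam X) (hY : Ev fam Y) : Ev fam (X ⊞ Y) :=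
  Ev.tri₂ (binaryBiproductTriangle_distinguished X Y) hX hY

end Ev

section HB
universe w v u
variable {C : Type u} [Category.{v} C] [Abelian C] [HasDerivedCategory.{w} C]
  (P : ObjectProperty C) [P.IsSerreClass]

/-- bounded homology in `P`. -/
def HB (X : DerivedCategory C) : Prop :=
  (∀ i : ℤ, P ((DerivedCategory.homologyFunctor C i).obj X)) ∧
    ∃ a b : ℤ, X.IsGE a ∧ X.IsLE b

variable {P}

lemma HB.iso {X Y : DerivedCategory C} (h : HB P X) (e : X ≅ Y) : HB P Y := by
  obtain ⟨h, a, b, ha, hb⟩ := h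
  exact ⟨fun i => P.prop_of_iso ((DerivedCategory.homologyFunctor C i).mapIso e) (h i), a, b,
    DerivedCategory.TStructure.t.isGE_of_iso e a, DerivedCategory.TStructure.t.isLE_of_iso e b⟩

lemma HB.shift {X : DerivedCategory C} (h : HB P X) (d : ℤ) : HB P (X⟦d⟧) := by
  obtain ⟨h, a, b, ha, hb⟩ := h
  refine ⟨fun i => ?_, a - d, b - d, ?_, ?_⟩
  · exact P.prop_of_iso (((DerivedCategory.homologyFunctor C 0).shiftIso d i (d + i) rfl).symm.app X)
      (h (d + i))
  · exact DerivedCategory.TStructure.t.isGE_shift _ a _ _ (by lia)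
  · exact DerivedCategory.TStructure.t.isLE_shift _ b _ _ (by lia)

lemma HB.tri₂ {t : Triangle (DerivedCategory C)} (ht : t ∈ distTriang (DerivedCategory C))
    (h1 : HB P t.obj₁) (h3 : HB P t.obj₃) : HB P t.obj₂ := by
  obtain ⟨h, a, b, ha, hb⟩ := h1
  obtain ⟨h', a', b', ha', hb'⟩ := h3
  refine ⟨fun i => P.prop_X₂_of_exact (DerivedCategory.HomologySequence.exact₂ t ht i) (h i) (h' i),
    min a a', max b b', ?_, ?_⟩
  · rw [DerivedCategory.isGE_iff] at *
    intro i hi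
    exact (DerivedCategory.HomologySequence.exact₂ t ht i).isZero_of_both_isZero (ha i (by lia)) (ha' i (by lia))
  · rw [DerivedCategory.isLE_iff] at *
    intro i hi
    exact (DerivedCategory.HomologySequence.exact₂ t ht i).isZero_of_both_isZero (hb i (by lia)) (hb' i (by lia))

lemma HB.tri₁ {t : Triangle (DerivedCategory C)} (ht : t ∈ distTriang (DerivedCategory C))
    (h2 : HB P t.obj₂) (h3 : HB P t.obj₃) : HB P t.obj₁ :=
  HB.tri₂ (inv_rot_of_distTriang _ ht) (h3.shift (-1)) h2

lemma HB.tri₃ {t : Triangle (DerivedCategory C)} (ht : t ∈ distTriang (DerivedCategory C))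
    (h1 : HB P t.obj₁) (h2 : HB P t.obj₂) : HB P t.obj₃ :=
  HB.tri₂ (rot_of_distTriang _ ht) h2 (h1.shift 1)

lemma HB.biprod {X Y : DerivedCategory C} (hX : HB P X) (hY : HB P Y) : HB P (X ⊞ Y) :=
  HB.tri₂ (binaryBiproductTriangle_distinguished X Y) hX hY

lemma HB.single {M : C} (hM : P M) (n : ℤ) : HB P ((DerivedCategory.singleFunctor C n).obj M) := by
  refine ⟨fun i => ?_, n, n, inferInstance, inferInstance⟩
  by_cases hi : i = n
  · subst hi
    exact P.prop_of_iso ((DerivedCategory.singleFunctorCompHomologyFunctorIso C i).symm.app M) hM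
  · refine P.prop_of_isZero ?_
    by_cases hi' : i < n
    · exact DerivedCategory.isZero_of_isGE _ n i hi'
    · exact DerivedCategory.isZero_of_isLE _ n i (by lia)

lemma isLE_of_iso' {X Y : DerivedCategory C} (e : X ≅ Y) (n : ℤ) (h : X.IsLE n) : Y.IsLE n :=
  DerivedCategory.TStructure.t.isLE_of_iso e n

end HB

end YT
end
end


section
open CategoryTheory CategoryTheory.Abelian Limits Pretriangulated
open scoped DirectSum ZeroObject
set_option linter.unusedSectionVars false
set_option linter.unusedVariables false

noncomputable section
namespace YT

section Top
universe w v u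
variable {C : Type u} [Category.{v} C] [Abelian C] [HasDerivedCategory.{w} C]

lemma epi_of_square {A B A' B' : C} (a : A ⟶ B) (b : A' ⟶ B') (l : A ≅ A') (r : B ≅ B')
    (h : a ≫ r.hom = l.hom ≫ b) (hb : Epi b) : Epi a := by
  have : a = l.hom ≫ b ≫ r.inv := by rw [← cancel_mono r.hom, h]; simp
  rw [this]; infer_instance

lemma exists_top_complex (K : CochainComplex C ℤ) (t : ℤ) [K.IsStrictlyLE t] (Q : C) [Projective Q]
    (q : Q ⟶ K.homology t) [Epi q] :
    ∃ φ : (CochainComplex.singleFunctor C t).obj Q ⟶ K, Epi (HomologicalComplex.homologyMap φ t) := by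
  let c : Q ⟶ K.cycles t := Projective.factorThru q (K.homologyπ t)
  have hc : c ≫ K.homologyπ t = q := Projective.factorThru_comp _ _
  let φ : (HomologicalComplex.single C (ComplexShape.up ℤ) t).obj Q ⟶ K :=
    HomologicalComplex.mkHomFromSingle (c ≫ K.iCycles t) (by intro k hk; simp)
  refine ⟨φ, ?_⟩
  have h1 : HomologicalComplex.cyclesMap φ t =
      (HomologicalComplex.singleObjCyclesSelfIso (ComplexShape.up ℤ) t Q).hom ≫ c := by
    rw [← cancel_mono (K.iCycles t)]
    simp [φ, HomologicalComplex.singleObjCyclesSelfIso_hom]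
  have h2 := HomologicalComplex.homologyπ_naturality φ t
  rw [h1, Category.assoc, hc] at h2
  have : Epi ((HomologicalComplex.singleObjCyclesSelfIso (ComplexShape.up ℤ) t Q).hom ≫ q) := inferInstance
  rw [← h2] at this
  exact epi_of_epi (HomologicalComplex.homologyπ _ t) (HomologicalComplex.homologyMap φ t)

lemma exists_top (X : DerivedCategory C) (t : ℤ) (hX : X.IsLE t) (Q : C) [Projective Q]
    (q : Q ⟶ (DerivedCategory.homologyFunctor C t).obj X) [Epi q] :
    ∃ f : (DerivedCategory.singleFunctor C t).obj Q ⟶ X,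
      Epi ((DerivedCategory.homologyFunctor C t).map f) := by
  obtain ⟨K, hK, ⟨e⟩⟩ := X.exists_iso_Q_obj_of_isLE t
  let e' : (DerivedCategory.homologyFunctor C t).obj X ≅ K.homology t :=
    (DerivedCategory.homologyFunctor C t).mapIso e ≪≫
      (DerivedCategory.homologyFunctorFactors C t).app K
  obtain ⟨φ, hφ⟩ := exists_top_complex K t Q (q ≫ e'.hom)
  have h := (DerivedCategory.homologyFunctorFactors C t).hom.naturality φ
  have h4 : Epi ((DerivedCategory.homologyFunctor C t).map (DerivedCategory.Q.map φ)) :=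
    epi_of_square _ (HomologicalComplex.homologyMap φ t)
      ((DerivedCategory.homologyFunctorFactors C t).app _)
      ((DerivedCategory.homologyFunctorFactors C t).app _) h hφ
  obtain ⟨ψ, hψ⟩ : ∃ ψ : (DerivedCategory.singleFunctor C t).obj Q ⟶ DerivedCategory.Q.obj K,
      Epi ((DerivedCategory.homologyFunctor C t).map ψ) := ⟨DerivedCategory.Q.map φ, h4⟩
  refine ⟨ψ ≫ e.inv, ?_⟩
  rw [Functor.map_comp]
  infer_instance

/-- killing the top cohomology -/
lemma exists_top_triangle (P : ObjectProperty C) [P.IsSerreClass]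
    (X : DerivedCategory C) (t : ℤ) (hX : X.IsLE t) (Q : C) [Projective Q]
    (q : Q ⟶ (DerivedCategory.homologyFunctor C t).obj X) [Epi q] :
    ∃ (Z : DerivedCategory C) (f : (DerivedCategory.singleFunctor C t).obj Q ⟶ X) (g : X ⟶ Z)
      (h : Z ⟶ ((DerivedCategory.singleFunctor C t).obj Q)⟦(1 : ℤ)⟧),
      Triangle.mk f g h ∈ distTriang (DerivedCategory C) ∧ Z.IsLE (t - 1) ∧
      (∀ a ≤ t - 1, X.IsGE a → Z.IsGE a) := by
  obtain ⟨f, hf⟩ := exists_top X t hX Q q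
  obtain ⟨Z, g, h, hT⟩ := distinguished_cocone_triangle f
  refine ⟨Z, f, g, h, hT, ?_, ?_⟩
  · rw [DerivedCategory.isLE_iff]
    intro i hi
    have ex := DerivedCategory.HomologySequence.exact₃ _ hT i (i + 1) rfl
    have z1 : IsZero ((DerivedCategory.homologyFunctor C (i + 1)).obj
      ((DerivedCategory.singleFunctor C t).obj Q)) :=
        DerivedCategory.isZero_of_isLE _ t _ (by lia)
    refine ex.isZero_of_both_zeros ?_ (z1.eq_zero_of_tgt _)
    by_cases hit : i = t
    · subst hit
      have ex2 := DerivedCategory.HomologySequence.exact₂ _ hT i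
      have : Epi ((DerivedCategory.homologyFunctor C i).map f) := hf
      have h0 : (DerivedCategory.homologyFunctor C i).map f ≫
          (DerivedCategory.homologyFunctor C i).map g = 0 := by
        rw [← Functor.map_comp]
        have : f ≫ g = 0 := comp_distTriang_mor_zero₁₂ _ hT
        rw [this, Functor.map_zero]
      exact hf.left_cancellation _ _ (h0.trans comp_zero.symm)
    · exact (DerivedCategory.isZero_of_isLE X t i (by lia)).eq_zero_of_src _
  · intro a ha hXa
    rw [DerivedCategory.isGE_iff]
    intro i hi
    have ex := DerivedCategory.HomologySequence.exact₃ _ hT i (i + 1) rfl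
    have z1 : IsZero ((DerivedCategory.homologyFunctor C (i + 1)).obj
      ((DerivedCategory.singleFunctor C t).obj Q)) :=
        DerivedCategory.isZero_of_isGE _ t _ (by lia)
    exact ex.isZero_of_both_isZero (DerivedCategory.isZero_of_isGE X a i hi) z1

lemma top_hom_zero (X : DerivedCategory C) (t : ℤ) (hX : X.IsLE t) (S : C)
    (h : ∀ f : X ⟶ (DerivedCategory.singleFunctor C t).obj S, f = 0)
    (g : (DerivedCategory.homologyFunctor C t).obj X ⟶ S) : g = 0 := by
  obtain ⟨U, V, hU, hV, i, p, d, hT⟩ :=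
    DerivedCategory.TStructure.t.exists_triangle X (t - 1) t (by lia)
  have hU' : U.IsLE (t - 1) := ⟨hU⟩
  have hV' : V.IsGE t := ⟨hV⟩
  have hVle : V.IsLE t := by
    rw [DerivedCategory.isLE_iff]
    intro k hk
    exact (DerivedCategory.HomologySequence.exact₃ _ hT k (k + 1) rfl).isZero_of_both_isZero
      (DerivedCategory.isZero_of_isLE X t k hk) (DerivedCategory.isZero_of_isLE U (t - 1) _ (by lia))
  obtain ⟨M, ⟨e⟩⟩ := V.exists_iso_singleFunctor_obj_of_isGE_of_isLE t
  have hVS : ∀ f : V ⟶ (DerivedCategory.singleFunctor C t).obj S, f = 0 := by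
    intro f
    obtain ⟨k, hk'⟩ : ∃ k : U⟦(1 : ℤ)⟧ ⟶ _, f = d ≫ k := Triangle.yoneda_exact₃ _ hT f (h _)
    have : (U⟦(1 : ℤ)⟧).IsLE (t - 2) :=
      DerivedCategory.TStructure.t.isLE_shift U (t - 1) 1 (t - 2) (by lia)
    have hk : k = 0 := DerivedCategory.TStructure.t.zero k (t - 2) t (by lia)
    rw [hk', hk, comp_zero]
  have hMS : ∀ f : M ⟶ S, f = 0 := by
    intro f
    apply (DerivedCategory.singleFunctor C t).map_injective
    have := hVS (e.hom ≫ (DerivedCategory.singleFunctor C t).map f)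
    rw [← cancel_epi e.hom, this]; simp
  have hmono : Mono ((DerivedCategory.homologyFunctor C t).map p) := by
    refine (DerivedCategory.HomologySequence.exact₂ _ hT t).mono_g ?_
    exact (DerivedCategory.isZero_of_isLE U (t - 1) t (by lia)).eq_zero_of_src _
  have hepi : Epi ((DerivedCategory.homologyFunctor C t).map p) := by
    refine (DerivedCategory.HomologySequence.exact₃ _ hT t (t + 1) rfl).epi_f ?_
    exact (DerivedCategory.isZero_of_isLE U (t - 1) (t + 1) (by lia)).eq_zero_of_tgt _
  have hiso : IsIso ((DerivedCategory.homologyFunctor C t).map p) := isIso_of_mono_of_epi _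
  let e2 : (DerivedCategory.homologyFunctor C t).obj X ≅ M :=
    asIso ((DerivedCategory.homologyFunctor C t).map p) ≪≫
      (DerivedCategory.homologyFunctor C t).mapIso e ≪≫
      (DerivedCategory.singleFunctorCompHomologyFunctorIso C t).app M
  rw [← cancel_epi e2.inv, hMS (e2.inv ≫ g), comp_zero]

end Top
end YT
end
end


section
open CategoryTheory CategoryTheory.Abelian Limits Pretriangulated
open scoped DirectSum ZeroObject
set_option linter.unusedSectionVars false
set_option linter.unusedVariables false

noncomputable section
namespace YT

section Shift
universe v u
variable {T : Type u} [Category.{v} T] [HasZeroObject T] [HasShift T ℤ] [Preadditive T]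
  [∀ n : ℤ, (shiftFunctor T n).Additive] [Pretriangulated T]

lemma shift_hom_zero {X Y : T} (d i : ℤ) (h : ∀ g : X ⟶ Y⟦i - d⟧, g = 0) (f : X⟦d⟧ ⟶ Y⟦i⟧) :
    f = 0 := by
  obtain ⟨g, hg⟩ := (shiftFunctor T d).map_surjective
    (f ≫ (shiftFunctorAdd' T (i - d) d i (by lia)).hom.app Y)
  rw [h g, Functor.map_zero] at hg
  have := congrArg (· ≫ (shiftFunctorAdd' T (i - d) d i (by lia)).inv.app Y) hg
  simpa using this.symm

/-- no maps to any shift of `S` -/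
def Van (S X : T) : Prop := ∀ (i : ℤ) (f : X ⟶ S⟦i⟧), f = 0

variable {S : T}

lemma Van.shift {X : T} (h : Van S X) (d : ℤ) : Van S (X⟦d⟧) :=
  fun i f => shift_hom_zero d i (h _) f

lemma Van.iso {X Y : T} (h : Van S X) (e : X ≅ Y) : Van S Y := by
  intro i f
  rw [← cancel_epi e.hom, h i (e.hom ≫ f), comp_zero]

lemma Van.tri₂ {t : Triangle T} (ht : t ∈ distTriang T) (h1 : Van S t.obj₁)
    (h3 : Van S t.obj₃) : Van S t.obj₂ := by
  intro i f
  obtain ⟨g, rfl⟩ := Triangle.yoneda_exact₂ t ht f (h1 i _)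
  rw [h3 i g, comp_zero]

lemma Van.tri₁ {t : Triangle T} (ht : t ∈ distTriang T) (h2 : Van S t.obj₂)
    (h3 : Van S t.obj₃) : Van S t.obj₁ :=
  Van.tri₂ (inv_rot_of_distTriang _ ht) (h3.shift (-1)) h2

lemma Van.tri₃ {t : Triangle T} (ht : t ∈ distTriang T) (h1 : Van S t.obj₁)
    (h2 : Van S t.obj₂) : Van S t.obj₃ :=
  Van.tri₂ (rot_of_distTriang _ ht) h2 (h1.shift 1)

lemma noeth_of_surj {R R' M M' : Type*} [Ring R] [Ring R'] [AddCommGroup M] [AddCommGroup M']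
    [Module R M] [Module R' M'] (φ : M →+ M') (σ : R → R') (h : ∀ r m, φ (r • m) = σ r • φ m)
    (surj : Function.Surjective φ) [hN : IsNoetherian R M] : IsNoetherian R' M' := by
  let c : Submodule R' M' → Submodule R M := fun N =>
    { carrier := {m | φ m ∈ N}
      add_mem' := fun {a b} ha hb => by
        show φ (a + b) ∈ N
        rw [map_add]; exact N.add_mem ha hb
      zero_mem' := by show φ 0 ∈ N; rw [map_zero]; exact N.zero_mem
      smul_mem' := fun r m hm => by
        show φ (r • m) ∈ N
        rw [h]; exact N.smul_mem _ hm }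
  have hc : StrictMono c := by
    intro N N' hlt
    refine lt_of_le_of_ne (fun m hm => hlt.le hm) ?_
    intro heq
    apply hlt.ne
    apply le_antisymm hlt.le
    intro x hx
    obtain ⟨m, rfl⟩ := surj x
    have : m ∈ c N' := hx
    rw [← heq] at this
    exact this
  rw [isNoetherian_iff'] at hN ⊢
  exact hc.wellFoundedGT

lemma noeth_iso_right {X G G' : T} (e : G ≅ G') [IsNoetherian (End G) (X ⟶ G)] :
    IsNoetherian (End G') (X ⟶ G') :=
  noeth_of_surj (R := End G) (M := X ⟶ G)
    (φ := { toFun := fun f => f ≫ e.hom, map_zero' := by simp, map_add' := by intros; simp })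
    (σ := fun r => (e.inv ≫ (show G ⟶ G from r) ≫ e.hom : G' ⟶ G'))
    (by
      intro r m
      show (m ≫ (show G ⟶ G from r)) ≫ e.hom = (m ≫ e.hom) ≫ (e.inv ≫ (show G ⟶ G from r) ≫ e.hom : G' ⟶ G')
      simp)
    (fun f => ⟨f ≫ e.inv, by simp⟩)

lemma noeth_tri₂ {t : Triangle T} (ht : t ∈ distTriang T) (G : T)
    [IsNoetherian (End G) (t.obj₁ ⟶ G)] [IsNoetherian (End G) (t.obj₃ ⟶ G)] :
    IsNoetherian (End G) (t.obj₂ ⟶ G) := by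
  let f : (t.obj₃ ⟶ G) →ₗ[End G] (t.obj₂ ⟶ G) :=
    { toFun := fun k => t.mor₂ ≫ k, map_add' := by intros; simp,
      map_smul' := fun r k => (Category.assoc _ _ _).symm }
  let g : (t.obj₂ ⟶ G) →ₗ[End G] (t.obj₁ ⟶ G) :=
    { toFun := fun k => t.mor₁ ≫ k, map_add' := by intros; simp,
      map_smul' := fun r k => (Category.assoc _ _ _).symm }
  refine isNoetherian_of_range_eq_ker f g (le_antisymm ?_ ?_)
  · rintro _ ⟨k, rfl⟩
    show t.mor₁ ≫ t.mor₂ ≫ k = 0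
    rw [← Category.assoc, comp_distTriang_mor_zero₁₂ _ ht, zero_comp]
  · intro k hk
    obtain ⟨k', hk'⟩ := Triangle.yoneda_exact₂ t ht k hk
    exact ⟨k', hk'.symm⟩

end Shift

lemma noeth_map {A B : Type*} [Category A] [Category B] [Preadditive A] [Preadditive B]
    (F : A ⥤ B) [F.Additive] [F.Full] (Q S : A) [IsNoetherian (End S) (Q ⟶ S)] :
    IsNoetherian (End (F.obj S)) (F.obj Q ⟶ F.obj S) :=
  noeth_of_surj (R := End S) (M := Q ⟶ S) (φ := F.mapAddHom)
    (σ := fun r => F.map (show S ⟶ S from r)) (fun r m => F.map_comp _ _) F.map_surjective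

section D
universe w v u
variable {C : Type u} [Category.{v} C] [Abelian C] [HasExt.{w} C] [HasDerivedCategory.{w} C]

/-- comparison of single functors -/
def sgShift (M : C) (t : ℤ) : (sg M)⟦-t⟧ ≅ (DerivedCategory.singleFunctor C t).obj M :=
  ((DerivedCategory.singleFunctors C).shiftIso (-t) t 0 (by lia)).app M

lemma pd_hom_zero {M : C} (d : ℕ) [HasProjectiveDimensionLT M d] (N : C) (i : ℤ) (hi : d ≤ i)
    (f : sg M ⟶ (sg N)⟦i⟧) : f = 0 := by
  obtain ⟨n, rfl⟩ := Int.eq_ofNat_of_zero_le (show 0 ≤ i by lia)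
  obtain ⟨α, rfl⟩ := (Ext.homEquiv (X := M) (Y := N) (n := n)).surjective f
  have : α = 0 := Ext.eq_zero_of_hasProjectiveDimensionLT α d (by exact_mod_cast hi)
  rw [this]
  exact Ext.zero_hom _ _ _

lemma ev_of_pd {M : C} (d : ℕ) [HasProjectiveDimensionLT M d] : Ev (fun N : C => sg N) (sg M) :=
  ⟨d, fun N i hi f => pd_hom_zero d N i hi f⟩

lemma pd_of_ev {M : C} (h : Ev (fun N : C => sg N) (sg M)) : ∃ d : ℕ, HasProjectiveDimensionLT M d := by
  obtain ⟨n, hn⟩ := h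
  refine ⟨n.toNat, (hasProjectiveDimensionLT_iff.{w} M _).2 ?_⟩
  intro i hi Y e
  apply (Ext.homEquiv (X := M) (Y := Y) (n := i)).injective
  exact (hn Y i (by lia) _).trans (Ext.zero_hom _ _ _).symm

lemma neg_hom_zero (M N : C) (i : ℤ) (hi : i < 0) (f : sg M ⟶ (sg N)⟦i⟧) : f = 0 := by
  have : ((sg N)⟦i⟧).IsGE (-i) := DerivedCategory.TStructure.t.isGE_shift _ 0 _ _ (by lia)
  exact DerivedCategory.TStructure.t.zero f 0 (-i) (by lia)

lemma van_proj {Q S : C} [Projective Q] (h : ∀ f : Q ⟶ S, f = 0) : Van (sg S) (sg Q) := by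
  intro i f
  obtain hi | rfl | hi := lt_trichotomy i 0
  · exact neg_hom_zero _ _ i hi f
  · rw [← cancel_mono ((shiftFunctorZero (DerivedCategory C) ℤ).hom.app (sg S)), zero_comp]
    obtain ⟨g, hg⟩ := (DerivedCategory.singleFunctor C 0).map_surjective
      (f ≫ (shiftFunctorZero (DerivedCategory C) ℤ).hom.app (sg S))
    rw [← hg, h g, Functor.map_zero]
  · have := (projective_iff_hasProjectiveDimensionLT_one (X := Q)).1 inferInstance
    exact pd_hom_zero 1 S i (by lia) f

lemma hom_zero_of_van {M S : C} (h : Van (sg S) (sg M)) (f : M ⟶ S) : f = 0 := by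
  apply (DerivedCategory.singleFunctor C 0).map_injective
  have := h 0 ((DerivedCategory.singleFunctor C 0).map f ≫
    (shiftFunctorZero (DerivedCategory C) ℤ).inv.app (sg S))
  rw [← cancel_mono ((shiftFunctorZero (DerivedCategory C) ℤ).inv.app (sg S)), this]
  simp

variable (P : ObjectProperty C) [P.IsSerreClass] (S : C)

lemma noeth_single (Q : C) [Projective Q] (t i : ℤ) [IsNoetherian (End S) (Q ⟶ S)] :
    IsNoetherian (End ((sg S)⟦i⟧)) ((DerivedCategory.singleFunctor C t).obj Q ⟶ (sg S)⟦i⟧) := by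
  by_cases hi : i = -t
  · subst hi
    have := noeth_map (DerivedCategory.singleFunctor C t) Q S
    exact noeth_iso_right (sgShift S t).symm
  · have : Subsingleton ((DerivedCategory.singleFunctor C t).obj Q ⟶ (sg S)⟦i⟧) := by
      refine subsingleton_of_forall_eq 0 (fun f => ?_)
      rw [← cancel_epi (sgShift Q t).hom, comp_zero]
      refine shift_hom_zero _ _ (fun g => ?_) _
      obtain hi' | hi' := lt_or_gt_of_ne hi
      · exact neg_hom_zero _ _ _ (by lia) g
      · have := (projective_iff_hasProjectiveDimensionLT_one (X := Q)).1 inferInstance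
        exact pd_hom_zero 1 S _ (by lia) g
    infer_instance

lemma noeth_hom (hcov : ∀ Z, P Z → ∃ (Q : C) (q : Q ⟶ Z), Projective Q ∧ P Q ∧ Epi q ∧
      IsNoetherian (End S) (Q ⟶ S)) (i : ℤ) (j : ℕ) :
    ∀ (t : ℤ) (X : DerivedCategory C), X.IsLE t →
      (∀ k, P ((DerivedCategory.homologyFunctor C k).obj X)) → i < -t + j →
      IsNoetherian (End ((sg S)⟦i⟧)) (X ⟶ (sg S)⟦i⟧) := by
  induction j with
  | zero =>
    intro t X hX hP hi
    have : Subsingleton (X ⟶ (sg S)⟦i⟧) := by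
      refine subsingleton_of_forall_eq 0 (fun f => ?_)
      have : ((sg S)⟦i⟧).IsGE (-i) := DerivedCategory.TStructure.t.isGE_shift _ 0 _ _ (by lia)
      exact DerivedCategory.TStructure.t.zero f t (-i) (by push_cast at hi; lia)
    infer_instance
  | succ j ih =>
    intro t X hX hP hi
    obtain ⟨Q, q, hQ, hPQ, hq, hN⟩ := hcov _ (hP t)
    obtain ⟨Z, f, g, h, hT, hZ, -⟩ := exists_top_triangle P X t hX Q q
    have hPZ : ∀ k, P ((DerivedCategory.homologyFunctor C k).obj Z) := fun k =>
      P.prop_X₂_of_exact (DerivedCategory.HomologySequence.exact₃ _ hT k (k + 1) rfl) (hP k)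
        ((HB.single hPQ t).1 (k + 1))
    have i1 := ih (t - 1) Z hZ hPZ (by push_cast at hi; lia)
    have i2 := noeth_single S Q t i
    exact @noeth_tri₂ _ _ _ _ _ _ _ _ hT _ i2 i1

end D
end YT
end
end


section
open CategoryTheory CategoryTheory.Abelian Limits Pretriangulated
open scoped DirectSum ZeroObject
set_option linter.unusedSectionVars false
set_option linter.unusedVariables false

noncomputable section
namespace YT

section Cover
universe v u
variable {T : Type u} [Category.{v} T] [HasZeroObject T] [HasShift T ℤ] [Preadditive T]
  [∀ n : ℤ, (shiftFunctor T n).Additive] [Pretriangulated T]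

lemma cover_finite (𝓕 : T → Prop) (h0 : 𝓕 0) (hb : ∀ F G, 𝓕 F → 𝓕 G → 𝓕 (F ⊞ G)) (X G : T)
    (hG : 𝓕 G) (s : Set (X ⟶ G)) (hs : s.Finite) :
    ∃ (F : T) (u : X ⟶ F), 𝓕 F ∧ ∀ h ∈ s, ∃ k : F ⟶ G, h = u ≫ k := by
  induction s, hs using Set.Finite.induction_on with
  | empty => exact ⟨0, 0, h0, fun h hh => absurd hh (Set.notMem_empty _)⟩
  | insert _ _ ih =>
    rename_i a s _ _
    obtain ⟨F, u, hF, hu⟩ := ih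
    refine ⟨F ⊞ G, biprod.lift u a, hb _ _ hF hG, fun h hh => ?_⟩
    rcases Set.mem_insert_iff.1 hh with rfl | hh
    · exact ⟨biprod.snd, by simp⟩
    · obtain ⟨k, hk⟩ := hu h hh
      exact ⟨biprod.fst ≫ k, by simp [hk]⟩

lemma cover_one (𝓕 : T → Prop) (h0 : 𝓕 0) (hb : ∀ F G, 𝓕 F → 𝓕 G → 𝓕 (F ⊞ G)) (X G : T)
    (hG : 𝓕 G) [IsNoetherian (End G) (X ⟶ G)] :
    ∃ (F : T) (u : X ⟶ F), 𝓕 F ∧ ∀ h : X ⟶ G, ∃ k : F ⟶ G, h = u ≫ k := by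
  obtain ⟨s, hs, hspan⟩ := Submodule.fg_def.1 (IsNoetherian.noetherian (⊤ : Submodule (End G) (X ⟶ G)))
  obtain ⟨F, u, hF, hu⟩ := cover_finite 𝓕 h0 hb X G hG s hs
  refine ⟨F, u, hF, fun h => ?_⟩
  have hh : h ∈ Submodule.span (End G) s := by rw [hspan]; trivial
  induction hh using Submodule.span_induction with
  | mem x hx => exact hu x hx
  | zero => exact ⟨0, by simp⟩
  | add x y _ _ hx hy =>
    obtain ⟨a, rfl⟩ := hx
    obtain ⟨b, rfl⟩ := hy
    exact ⟨a + b, by simp⟩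
  | smul r x _ hx =>
    obtain ⟨a, rfl⟩ := hx
    exact ⟨a ≫ r, Category.assoc _ _ _⟩

lemma cover_many (𝓕 : T → Prop) (h0 : 𝓕 0) (hb : ∀ F G, 𝓕 F → 𝓕 G → 𝓕 (F ⊞ G)) (X S : T)
    (hG : ∀ i : ℤ, 𝓕 (S⟦i⟧)) (hN : ∀ i : ℤ, IsNoetherian (End (S⟦i⟧)) (X ⟶ S⟦i⟧)) (I : Finset ℤ) :
    ∃ (F : T) (u : X ⟶ F), 𝓕 F ∧ ∀ i ∈ I, ∀ h : X ⟶ S⟦i⟧, ∃ k : F ⟶ S⟦i⟧, h = u ≫ k := by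
  induction I using Finset.induction_on with
  | empty => exact ⟨0, 0, h0, fun h hh => absurd hh (Finset.notMem_empty _)⟩
  | insert a s _ ih =>
    obtain ⟨F, u, hF, hu⟩ := ih
    have := hN a
    obtain ⟨F', u', hF', hu'⟩ := cover_one 𝓕 h0 hb X (S⟦a⟧) (hG a)
    refine ⟨F ⊞ F', biprod.lift u u', hb _ _ hF hF', fun i hi h => ?_⟩
    rcases Finset.mem_insert.1 hi with rfl | hi
    · obtain ⟨k, hk⟩ := hu' h
      exact ⟨biprod.snd ≫ k, by simp [hk]⟩
    · obtain ⟨k, hk⟩ := hu i hi h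
      exact ⟨biprod.fst ≫ k, by simp [hk]⟩

end Cover

section Good
universe w v u w' v' u'
variable {C : Type u} [Category.{v} C] [Abelian C] [HasExt.{w} C] [HasDerivedCategory.{w} C]
variable {D : Type u'} [Category.{v'} D] [Abelian D] [HasExt.{w'} D] [HasDerivedCategory.{w'} D]
  (Φ : C ⥤ D) [Φ.Additive] [PreservesFiniteLimits Φ] [PreservesFiniteColimits Φ]

/-- the image has bounded projective dimension. -/
def Good (X : DerivedCategory C) : Prop :=
  Ev (fun N : D => sg N) (Φ.mapDerivedCategory.obj X)

variable {Φ}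

lemma Good.retract {X Y : DerivedCategory C} (h : Good Φ X) (r : Y ⟶ X) (s : X ⟶ Y)
    (hrs : r ≫ s = 𝟙 Y) : Good Φ Y :=
  Ev.retract h (Φ.mapDerivedCategory.map r) (Φ.mapDerivedCategory.map s)
    (by rw [← Functor.map_comp, hrs, CategoryTheory.Functor.map_id])

lemma Good.iso {X Y : DerivedCategory C} (h : Good Φ X) (e : X ≅ Y) : Good Φ Y :=
  h.retract e.inv e.hom (by simp)

lemma Good.shift {X : DerivedCategory C} (h : Good Φ X) (d : ℤ) : Good Φ (X⟦d⟧) :=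
  Ev.iso (Ev.shift h d) ((Φ.mapDerivedCategory.commShiftIso d).symm.app X)

lemma Good.tri₂ {t : Triangle (DerivedCategory C)} (ht : t ∈ distTriang (DerivedCategory C))
    (h1 : Good Φ t.obj₁) (h3 : Good Φ t.obj₃) : Good Φ t.obj₂ :=
  Ev.tri₂ (Φ.mapDerivedCategory.map_distinguished t ht) h1 h3

lemma Good.tri₁ {t : Triangle (DerivedCategory C)} (ht : t ∈ distTriang (DerivedCategory C))
    (h2 : Good Φ t.obj₂) (h3 : Good Φ t.obj₃) : Good Φ t.obj₁ :=
  Good.tri₂ (inv_rot_of_distTriang _ ht) (h3.shift (-1)) h2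

lemma Good.tri₃ {t : Triangle (DerivedCategory C)} (ht : t ∈ distTriang (DerivedCategory C))
    (h1 : Good Φ t.obj₁) (h2 : Good Φ t.obj₂) : Good Φ t.obj₃ :=
  Good.tri₂ (rot_of_distTriang _ ht) h2 (h1.shift 1)

lemma Good.biprod {X Y : DerivedCategory C} (hX : Good Φ X) (hY : Good Φ Y) : Good Φ (X ⊞ Y) :=
  Good.tri₂ (binaryBiproductTriangle_distinguished X Y) hX hY

lemma Good.sg_proj {Q : C} [Projective (Φ.obj Q)] : Good Φ (sg Q) := by
  have := (projective_iff_hasProjectiveDimensionLT_one (X := Φ.obj Q)).1 inferInstance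
  exact Ev.iso (ev_of_pd 1) ((Φ.mapDerivedCategorySingleFunctor 0).symm.app Q)

lemma Good.sg_zero {S : C} (h : IsZero (Φ.obj S)) : Good Φ (sg S) := by
  have : Projective (Φ.obj S) := h.projective
  exact Good.sg_proj

lemma Good.zero {X : DerivedCategory C} (h : IsZero X) : Good Φ X :=
  Ev.zero (Φ.mapDerivedCategory.map_isZero h)

lemma pd_of_good {M : C} (h : Good Φ (sg M)) : ∃ d : ℕ, HasProjectiveDimensionLT (Φ.obj M) d :=
  pd_of_ev (Ev.iso h ((Φ.mapDerivedCategorySingleFunctor 0).app M))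

variable (P : ObjectProperty C) [P.IsSerreClass] (S : C)

lemma good_single_of_van
    (h2 : ∀ Z, P Z → (∀ f : Z ⟶ S, f = 0) → ∃ (Q : C) (q : Q ⟶ Z), Projective Q ∧ P Q ∧ Epi q ∧
      (∀ f : Q ⟶ S, f = 0) ∧ Projective (Φ.obj Q)) (d : ℕ) :
    ∀ M : C, P M → HasProjectiveDimensionLT M (d + 1) → Van (sg S) (sg M) → Good Φ (sg M) := by
  induction d with
  | zero =>
    intro M hM hd hv
    obtain ⟨Q, q, hQ, hPQ, hq, hQS, hΦ⟩ := h2 M hM (hom_zero_of_van hv)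
    have : Projective M := (projective_iff_hasProjectiveDimensionLT_one (X := M)).2 hd
    refine Good.retract (Good.sg_proj (Q := Q)) ((DerivedCategory.singleFunctor C 0).map
      (Projective.factorThru (𝟙 M) q)) ((DerivedCategory.singleFunctor C 0).map q) ?_
    rw [← Functor.map_comp, Projective.factorThru_comp, CategoryTheory.Functor.map_id]
  | succ d ih =>
    intro M hM hd hv
    obtain ⟨Q, q, hQ, hPQ, hq, hQS, hΦ⟩ := h2 M hM (hom_zero_of_van hv)
    let E : ShortComplex C := ShortComplex.mk (kernel.ι q) q (kernel.condition q)
    have hE : E.ShortExact := { exact := ShortComplex.exact_kernel q }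
    have hT := hE.singleTriangle_distinguished
    have hK : HasProjectiveDimensionLT (kernel q) (d + 1) :=
      (hE.hasProjectiveDimensionLT_X₃_iff d hQ).1 hd
    have hKv : Van (sg S) (sg (kernel q)) := Van.tri₁ hT (van_proj hQS) hv
    have hPK : P (kernel q) := P.prop_X₁_of_shortExact hE hPQ
    exact Good.tri₃ hT (ih _ hPK hK hKv) Good.sg_proj

lemma good_of_van (d : ℕ) (hd : ∀ M : C, HasProjectiveDimensionLT M (d + 1))
    (h2 : ∀ Z, P Z → (∀ f : Z ⟶ S, f = 0) → ∃ (Q : C) (q : Q ⟶ Z), Projective Q ∧ P Q ∧ Epi q ∧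
      (∀ f : Q ⟶ S, f = 0) ∧ Projective (Φ.obj Q)) (a : ℤ) (j : ℕ) :
    ∀ X : DerivedCategory C, HB P X → X.IsGE a → X.IsLE (a + j) → Van (sg S) X → Good Φ X := by
  induction j with
  | zero =>
    intro X hX ha hb hv
    have hb' : X.IsLE a := by simpa using hb
    obtain ⟨M, ⟨e⟩⟩ := X.exists_iso_singleFunctor_obj_of_isGE_of_isLE a
    let e' : X ≅ (sg M)⟦-a⟧ := e ≪≫ (sgShift M a).symm
    have e2 : X⟦a⟧ ≅ sg M := (shiftFunctor _ a).mapIso e' ≪≫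
      (shiftFunctorCompIsoId (DerivedCategory C) (-a) a (by lia)).app _
    have hM : P M := P.prop_of_iso ((DerivedCategory.homologyFunctor C a).mapIso e ≪≫
      (DerivedCategory.singleFunctorCompHomologyFunctorIso C a).app M) (hX.1 a)
    exact ((good_single_of_van P S h2 d M hM (hd M) ((hv.shift a).iso e2)).shift (-a)).iso e'.symm
  | succ j ih =>
    intro X hX ha hb hv
    have hb' : X.IsLE (a + j + 1) := by push_cast at hb; rwa [← add_assoc] at hb
    obtain ⟨Q, q, hQ, hPQ, hq, hQS, hΦ⟩ := h2 _ (hX.1 (a + j + 1)) (by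
      refine top_hom_zero X _ hb' S (fun f => ?_)
      rw [← cancel_mono (sgShift S _).inv, hv _ (f ≫ (sgShift S _).inv), zero_comp])
    obtain ⟨Z, f, g, h, hT, hZ, hZ'⟩ := exists_top_triangle P X _ hb' Q q
    have hZP : HB P Z := HB.tri₃ hT (HB.single hPQ _) hX
    have hZle : Z.IsLE (a + j) := by simpa using hZ
    have hQv : Van (sg S) ((DerivedCategory.singleFunctor C (a + j + 1)).obj Q) :=
      ((van_proj hQS).shift _).iso (sgShift Q _)
    have hQg : Good Φ ((DerivedCategory.singleFunctor C (a + j + 1)).obj Q) :=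
      (Good.sg_proj.shift _).iso (sgShift Q _)
    have hZv : Van (sg S) Z := Van.tri₃ hT hQv hv
    exact Good.tri₂ hT hQg (ih Z hZP (hZ' a (by lia) ha) hZle hZv)

lemma good_of_van' (d : ℕ) (hd : ∀ M : C, HasProjectiveDimensionLT M (d + 1))
    (h2 : ∀ Z, P Z → (∀ f : Z ⟶ S, f = 0) → ∃ (Q : C) (q : Q ⟶ Z), Projective Q ∧ P Q ∧ Epi q ∧
      (∀ f : Q ⟶ S, f = 0) ∧ Projective (Φ.obj Q))
    (X : DerivedCategory C) (hX : HB P X) (hv : Van (sg S) X) : Good Φ X := by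
  obtain ⟨-, a, b, ha, hb⟩ := id hX
  refine good_of_van P S d hd h2 a (b - a).toNat X hX ha ?_ hv
  exact DerivedCategory.TStructure.t.isLE_of_le X b _ (by lia)

/-- objects to which the tower argument applies. -/
structure KK (X : DerivedCategory C) : Prop where
  hb : HB P X
  ev : Ev (fun _ : Unit => sg S) X

variable {P S}

lemma KK.tri₃ {t : Triangle (DerivedCategory C)} (ht : t ∈ distTriang (DerivedCategory C))
    (h1 : KK P S t.obj₁) (h2 : KK P S t.obj₂) : KK P S t.obj₃ :=
  ⟨HB.tri₃ ht h1.hb h2.hb, Ev.tri₃ ht h1.ev h2.ev⟩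

lemma KK.biprod {X Y : DerivedCategory C} (h1 : KK P S X) (h2 : KK P S Y) : KK P S (X ⊞ Y) :=
  ⟨h1.hb.biprod h2.hb, h1.ev.biprod h2.ev⟩

lemma KK.shift {X : DerivedCategory C} (h1 : KK P S X) (d : ℤ) : KK P S (X⟦d⟧) :=
  ⟨h1.hb.shift d, h1.ev.shift d⟩

lemma KK.single {M : C} (hM : P M) (d : ℕ) [HasProjectiveDimensionLT M d] : KK P S (sg M) :=
  ⟨HB.single hM 0, d, fun _ i hi f => pd_hom_zero d S i hi f⟩

lemma HB.zero {X : DerivedCategory C} (h : IsZero X) : HB P X := by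
  have e : X ≅ sg (0 : C) := h.iso ((DerivedCategory.singleFunctor C 0).map_isZero (isZero_zero C))
  exact (HB.single (P.prop_of_isZero (isZero_zero C)) 0).iso e.symm

lemma exists_cover (hcov : ∀ Z, P Z → ∃ (Q : C) (q : Q ⟶ Z), Projective Q ∧ P Q ∧ Epi q ∧
      IsNoetherian (End S) (Q ⟶ S)) (hS : P S) (hΦS : IsZero (Φ.obj S)) (d : ℕ)
      (hd : HasProjectiveDimensionLT S d) (X : DerivedCategory C) (hX : KK P S X) :
    ∃ (F : DerivedCategory C) (u : X ⟶ F), KK P S F ∧ Nice S F ∧ Good Φ F ∧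
      ∀ (i : ℤ) (h : X ⟶ (sg S)⟦i⟧), ∃ k : F ⟶ (sg S)⟦i⟧, h = u ≫ k := by
  obtain ⟨hP, a, b, ha, hb⟩ := id hX.hb
  obtain ⟨n, hn⟩ := id hX.ev
  have hN : ∀ i : ℤ, IsNoetherian (End ((sg S)⟦i⟧)) (X ⟶ (sg S)⟦i⟧) := fun i =>
    noeth_hom P S hcov i (i + b + 1).toNat b X hb hP (by lia)
  obtain ⟨F, u, ⟨h1, h2, h3⟩, hu⟩ := cover_many (fun F => KK P S F ∧ Nice S F ∧ Good Φ F)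
    ⟨⟨HB.zero (isZero_zero _), Ev.zero (isZero_zero _)⟩, Nice.zero, Good.zero (isZero_zero _)⟩
    (fun F G h h' => ⟨h.1.biprod h'.1, h.2.1.biprod h'.2.1, h.2.2.biprod h'.2.2⟩) X (sg S)
    (fun i => ⟨(KK.single hS d).shift i, Nice.shift d (fun n hn =>
      HasProjectiveDimensionLT.subsingleton S d n hn S) i, (Good.sg_zero hΦS).shift i⟩)
    hN (Finset.Icc (-b) n)
  refine ⟨F, u, h1, h2, h3, fun i h => ?_⟩
  by_cases hi : i ∈ Finset.Icc (-b) n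
  · exact hu i hi h
  · refine ⟨0, ?_⟩
    rw [comp_zero]
    simp only [Finset.mem_Icc, not_and_or, not_le] at hi
    obtain hi | hi := hi
    · have : ((sg S)⟦i⟧).IsGE (-i) := DerivedCategory.TStructure.t.isGE_shift _ 0 _ _ (by lia)
      exact DerivedCategory.TStructure.t.zero h b (-i) (by lia)
    · exact hn () i hi.le h

end Good
end YT
end
end


section
open CategoryTheory CategoryTheory.Abelian Limits Pretriangulated
open scoped DirectSum ZeroObject
set_option linter.unusedSectionVars false
set_option linter.unusedVariables false

noncomputable section
namespace YT

section Tow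
universe v u
variable {T : Type u} [Category.{v} T] [HasZeroObject T] [HasShift T ℤ] [Preadditive T]
  [∀ n : ℤ, (shiftFunctor T n).Additive] [Pretriangulated T]

/-- all morphisms to shifts of `S` factor through `u`. -/
def Cov (S : T) {X F : T} (u : X ⟶ F) : Prop :=
  ∀ (i : ℤ) (h : X ⟶ S⟦i⟧), ∃ k : F ⟶ S⟦i⟧, h = u ≫ k

lemma Cov.shift {S X F : T} {u : X ⟶ F} (hu : Cov S u) (d i : ℤ) (f : X⟦d⟧ ⟶ S⟦i⟧) :
    ∃ k : F⟦d⟧ ⟶ S⟦i⟧, f = (shiftFunctor T d).map u ≫ k := by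
  obtain ⟨g, hg⟩ := (shiftFunctor T d).map_surjective
    (f ≫ (shiftFunctorAdd' T (i - d) d i (by lia)).hom.app S)
  obtain ⟨k, rfl⟩ := hu _ g
  refine ⟨(shiftFunctor T d).map k ≫ (shiftFunctorAdd' T (i - d) d i (by lia)).inv.app S, ?_⟩
  rw [← cancel_mono ((shiftFunctorAdd' T (i - d) d i (by lia)).hom.app S), ← hg]
  simp

lemma Cov.inj {S : T} {t : Triangle T} (ht : t ∈ distTriang T) (hu : Cov S t.mor₁) (i : ℤ)
    (k : t.obj₃ ⟶ S⟦i⟧) (hk : t.mor₂ ≫ k = 0) : k = 0 := by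
  obtain ⟨k', rfl⟩ := Triangle.yoneda_exact₃ t ht k hk
  obtain ⟨k'', rfl⟩ := hu.shift 1 i k'
  rw [← Category.assoc, comp_distTriang_mor_zero₃₁ _ ht, zero_comp]

lemma Cov.van {S : T} {t : Triangle T} (ht : t ∈ distTriang T) (hu : Cov S t.mor₁)
    (hi : ∀ (i : ℤ) (h : t.obj₂ ⟶ S⟦i⟧), t.mor₁ ≫ h = 0 → h = 0) : Van S t.obj₃ := by
  intro i k
  refine hu.inj ht i k (hi i _ ?_)
  rw [← Category.assoc, comp_distTriang_mor_zero₁₂ _ ht, zero_comp]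

end Tow

section Main
universe w v u w' v' u'
variable {C : Type u} [Category.{v} C] [Abelian C] [HasExt.{w} C] [HasDerivedCategory.{w} C]
variable {D : Type u'} [Category.{v'} D] [Abelian D] [HasExt.{w'} D] [HasDerivedCategory.{w'} D]
  {Φ : C ⥤ D} [Φ.Additive] [PreservesFiniteLimits Φ] [PreservesFiniteColimits Φ]
  {P : ObjectProperty C} [P.IsSerreClass] {S : C}

lemma hs_zero {X : DerivedCategory C} (i : ℤ) : hs (M := S) i (0 : X ⟶ (sg S)⟦i⟧) = 0 := by
  refine Hmod.ext fun j => ?_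
  by_cases hj : j = i
  · subst hj; simp
  · rw [hs_ne hj]; rfl

lemma Hmap_surj {X F : DerivedCategory C} {u : X ⟶ F} (hu : Cov (sg S) u) :
    Function.Surjective (Hmap (M := S) u) := by
  intro h
  choose k hk using fun i => hu i (h i)
  exact ⟨k, Hmod.ext fun i => (hk i).symm⟩

lemma Hmap_inj {t : Triangle (DerivedCategory C)} (ht : t ∈ distTriang _)
    (hu : Cov (sg S) t.mor₁) : Function.Injective (Hmap (M := S) t.mor₂) := by
  rw [← LinearMap.ker_eq_bot, LinearMap.ker_eq_bot']
  intro h hh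
  refine Hmod.ext fun i => ?_
  refine hu.inj ht i _ ?_
  have := congrFun hh i
  exact this

lemma Hmap_exact {t : Triangle (DerivedCategory C)} (ht : t ∈ distTriang _) (h : Hmod S t.obj₂) :
    Hmap t.mor₁ h = 0 ↔ ∃ k, Hmap t.mor₂ k = h := by
  constructor
  · intro hh
    have : ∀ i, ∃ k : t.obj₃ ⟶ (sg S)⟦i⟧, h i = t.mor₂ ≫ k := fun i =>
      Triangle.yoneda_exact₂ t ht (h i) (congrFun hh i)
    choose k hk using this
    exact ⟨k, Hmod.ext fun i => (hk i).symm⟩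
  · rintro ⟨k, rfl⟩
    refine Hmod.ext fun i => ?_
    rw [Hmap_apply, Hmap_apply, ← Category.assoc, comp_distTriang_mor_zero₁₂ _ ht, zero_comp]
    rfl

/-- the base case of the tower argument. -/
lemma good_of_projective (d : ℕ) (hd : ∀ M : C, HasProjectiveDimensionLT M (d + 1))
    (h2 : ∀ Z, P Z → (∀ f : Z ⟶ S, f = 0) → ∃ (Q : C) (q : Q ⟶ Z), Projective Q ∧ P Q ∧ Epi q ∧
      (∀ f : Q ⟶ S, f = 0) ∧ Projective (Φ.obj Q))
    (t : Triangle (DerivedCategory C)) (ht : t ∈ distTriang _) (hX : HB P t.obj₁)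
    (hu : Cov (sg S) t.mor₁) (hF : HB P t.obj₂) (hN : Nice S t.obj₂) (hG : Good Φ t.obj₂)
    (hp : Module.Projective (ExtRing S)ᵐᵒᵖ (Hmod S t.obj₁)) : Good Φ t.obj₁ := by
  obtain ⟨σ, hσ⟩ := Module.projective_lifting_property (Hmap (M := S) t.mor₁) LinearMap.id
    (Hmap_surj hu)
  have hσ' : ∀ x, Hmap t.mor₁ (σ x) = x := fun x => LinearMap.congr_fun hσ x
  have hex : ∀ h : Hmod S t.obj₂, ∃ k, Hmap t.mor₂ k = h - σ (Hmap t.mor₁ h) := fun h =>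
    (Hmap_exact ht _).1 (by rw [map_sub, hσ', sub_self])
  choose r hr using hex
  have hinj := Hmap_inj ht hu
  let ρ : Hmod S t.obj₂ →ₗ[(ExtRing S)ᵐᵒᵖ] Hmod S t.obj₃ :=
    { toFun := r
      map_add' := fun a b => hinj (by simp only [map_add, hr]; abel)
      map_smul' := fun a b => hinj (by simp only [map_smul, hr, RingHom.id_apply, smul_sub]) }
  have hρ : ∀ k, ρ (Hmap t.mor₂ k) = k := fun k => hinj (by
    show Hmap t.mor₂ (r _) = _
    rw [hr, (Hmap_exact ht (Hmap t.mor₂ k)).2 ⟨k, rfl⟩, map_zero, sub_zero])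
  obtain ⟨v, hv⟩ := hN.real _ ρ
  have hv' : ∀ (i : ℤ) (k : t.obj₃ ⟶ (sg S)⟦i⟧), v ≫ t.mor₂ ≫ k = k := by
    intro i k
    rw [← hv, ← Hmap_hs, hρ, hs_same]
  let w : t.obj₁ ⊞ t.obj₃ ⟶ t.obj₂ := biprod.desc t.mor₁ v
  obtain ⟨Z, g, h, hT⟩ := distinguished_cocone_triangle w
  have hcov : Cov (sg S) w := by
    intro i a
    obtain ⟨k, hk⟩ := hu i (biprod.inl ≫ a)
    refine ⟨k + t.mor₂ ≫ (biprod.inr ≫ a - v ≫ k), ?_⟩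
    apply biprod.hom_ext'
    · rw [hk]
      simp only [w, biprod.inl_desc_assoc, Preadditive.comp_add]
      rw [← Category.assoc t.mor₁, comp_distTriang_mor_zero₁₂ _ ht, zero_comp, add_zero]
    · simp only [w, biprod.inr_desc_assoc, Preadditive.comp_add]
      rw [hv']
      abel
  have hZ : Van (sg S) Z := by
    refine Cov.van hT hcov ?_
    intro i (h : t.obj₂ ⟶ _) (hh : w ≫ h = 0)
    have h1 : t.mor₁ ≫ h = 0 := by
      rw [← biprod.inl_desc t.mor₁ v, Category.assoc]
      exact (congrArg (biprod.inl ≫ ·) hh).trans comp_zero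
    have h2 : v ≫ h = 0 := by
      rw [← biprod.inr_desc t.mor₁ v, Category.assoc]
      exact (congrArg (biprod.inr ≫ ·) hh).trans comp_zero
    obtain ⟨k, rfl⟩ := Triangle.yoneda_exact₂ t ht h h1
    rw [hv'] at h2
    rw [h2]
    exact comp_zero
  have hT3 : HB P t.obj₃ := HB.tri₃ ht hX hF
  have hZ' : HB P Z := HB.tri₃ hT (hX.biprod hT3) hF
  have hZg : Good Φ Z := good_of_van' P S d hd h2 Z hZ' hZ
  have : Good Φ (t.obj₁ ⊞ t.obj₃) := Good.tri₁ hT hG hZg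
  exact this.retract biprod.inl biprod.fst (by simp)

lemma good_tower (d : ℕ) (hd : ∀ M : C, HasProjectiveDimensionLT M (d + 1))
    (h2 : ∀ Z, P Z → (∀ f : Z ⟶ S, f = 0) → ∃ (Q : C) (q : Q ⟶ Z), Projective Q ∧ P Q ∧ Epi q ∧
      (∀ f : Q ⟶ S, f = 0) ∧ Projective (Φ.obj Q))
    (hcov : ∀ Z, P Z → ∃ (Q : C) (q : Q ⟶ Z), Projective Q ∧ P Q ∧ Epi q ∧
      IsNoetherian (End S) (Q ⟶ S)) (hS : P S) (hΦS : IsZero (Φ.obj S)) (m : ℕ) :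
    ∀ (X : DerivedCategory C), KK P S X →
      HasProjectiveDimensionLT (ModuleCat.of (ExtRing S)ᵐᵒᵖ (Hmod S X)) (m + 1) → Good Φ X := by
  induction m with
  | zero =>
    intro X hX hm
    obtain ⟨F, u, h1, hN, hG, hu⟩ := exists_cover (Φ := Φ) hcov hS hΦS _ (hd S) X hX
    obtain ⟨Z, g, h, hT⟩ := distinguished_cocone_triangle u
    refine good_of_projective d hd h2 _ hT hX.hb hu h1.hb hN hG ?_
    have := (projective_iff_hasProjectiveDimensionLT_one
      (X := ModuleCat.of (ExtRing S)ᵐᵒᵖ (Hmod S X))).2 hm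
    exact (IsProjective.iff_projective (R := (ExtRing S)ᵐᵒᵖ) (Hmod S X)).2 this
  | succ m ih =>
    intro X hX hm
    obtain ⟨F, u, h1, hN, hG, hu⟩ := exists_cover (Φ := Φ) hcov hS hΦS _ (hd S) X hX
    obtain ⟨Z, g, h, hT⟩ := distinguished_cocone_triangle u
    have hZ : KK P S Z := KK.tri₃ hT hX h1
    let sc : ShortComplex (ModuleCat (ExtRing S)ᵐᵒᵖ) :=
      ShortComplex.mk (ModuleCat.ofHom (Hmap (M := S) g)) (ModuleCat.ofHom (Hmap (M := S) u)) (by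
        refine ModuleCat.hom_ext (LinearMap.ext fun k => ?_)
        exact (Hmap_exact hT _).2 ⟨k, rfl⟩)
    have hsc : sc.ShortExact :=
      { exact := by
          rw [ShortComplex.moduleCat_exact_iff]
          intro k hk
          exact (Hmap_exact hT k).1 hk
        mono_f := by
          rw [ModuleCat.mono_iff_injective]
          exact Hmap_inj hT hu
        epi_g := by
          rw [ModuleCat.epi_iff_surjective]
          exact Hmap_surj hu }
    have hpF : Projective sc.X₂ :=
      (IsProjective.iff_projective (R := (ExtRing S)ᵐᵒᵖ) (Hmod S F)).1 hN.proj
    have hm' : HasProjectiveDimensionLT (ModuleCat.of (ExtRing S)ᵐᵒᵖ (Hmod S Z)) (m + 1) :=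
      (hsc.hasProjectiveDimensionLT_X₃_iff m hpF).1 hm
    exact Good.tri₁ hT hG (ih Z hZ hm')

theorem abstract_main (d : ℕ) (hd : ∀ M : C, HasProjectiveDimensionLT M (d + 1))
    (h2 : ∀ Z, P Z → (∀ f : Z ⟶ S, f = 0) → ∃ (Q : C) (q : Q ⟶ Z), Projective Q ∧ P Q ∧ Epi q ∧
      (∀ f : Q ⟶ S, f = 0) ∧ Projective (Φ.obj Q))
    (hcov : ∀ Z, P Z → ∃ (Q : C) (q : Q ⟶ Z), Projective Q ∧ P Q ∧ Epi q ∧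
      IsNoetherian (End S) (Q ⟶ S)) (hS : P S) (hΦS : IsZero (Φ.obj S)) (m : ℕ)
    (hY : ∀ N : ModuleCat.{w} (ExtRing S)ᵐᵒᵖ, HasProjectiveDimensionLT N (m + 1))
    (M : C) (hM : P M) : ∃ n : ℕ, HasProjectiveDimensionLT (Φ.obj M) n := by
  have := hd M
  exact pd_of_good (good_tower d hd h2 hcov hS hΦS m (sg M) (KK.single hM (d + 1)) (hY _))

end Main
end YT
end
end


section
open CategoryTheory CategoryTheory.Abelian Limits Pretriangulated
open scoped DirectSum ZeroObject
set_option linter.unusedSectionVars false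
set_option linter.unusedVariables false

noncomputable section
namespace YT

section RT
universe u
variable {A : Type u} [Ring A]

lemma mem_rad {x : A} : x ∈ ringRadical A ↔ x ∈ Ring.jacobson A := by
  rw [← Ideal.jacobson_bot, Ideal.mem_jacobson_iff]
  show x ∈ (⊥ : TwoSidedIdeal A).jacobson ↔ _
  rw [TwoSidedIdeal.mem_jacobson_iff]
  simp [TwoSidedIdeal.mem_bot]

lemma mem_J {x : A} : x ∈ Ring.jacobson A ↔ ∀ y, ∃ z, z * (1 + y * x) = 1 := by
  rw [← Ideal.jacobson_bot, Ideal.mem_jacobson_iff]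
  refine forall_congr' fun y => exists_congr fun z => ?_
  rw [Ideal.mem_bot, sub_eq_zero, mul_add, mul_one, mul_assoc, add_comm]

variable (A) in
/-- reduction modulo the radical -/
abbrev bar : A →+* A ⧸ Ring.jacobson A := Ideal.Quotient.mk _

lemma bar_eq_zero {x : A} : bar A x = 0 ↔ x ∈ Ring.jacobson A := Ideal.Quotient.eq_zero_iff_mem

lemma unit_of_bar {x : A} (h : bar A x = 0) : IsUnit (1 + x) := by
  obtain ⟨z, hz⟩ := mem_J.1 (bar_eq_zero.1 h) 1
  rw [one_mul] at hz
  have hz' : bar A (z - 1) = 0 := by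
    have := congrArg (bar A) hz
    rw [map_mul, map_add, h, map_one, add_zero, mul_one] at this
    rw [map_sub, this, map_one, sub_self]
  obtain ⟨w, hw⟩ := mem_J.1 (bar_eq_zero.1 hz') 1
  rw [one_mul, add_sub_cancel] at hw
  have : w = 1 + x := by
    calc w = w * (z * (1 + x)) := by rw [hz, mul_one]
      _ = 1 + x := by rw [← mul_assoc, hw, one_mul]
  rw [this] at hw
  exact ⟨⟨1 + x, z, hw, hz⟩, rfl⟩

lemma idem_bar {g : A} (hg : g * g = g) (h : bar A g = 0) : g = 0 := by
  have hu := unit_of_bar (x := -g) (by rw [map_neg, h, neg_zero])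
  have : (1 + -g) * g = 0 := by rw [add_mul, neg_mul, hg, one_mul, add_neg_cancel]
  exact hu.mul_right_eq_zero.1 this

lemma local_gen {f : A} {hf : IsIdempotentElem f} (hl : IsLocalRing (CornerRing f hf)) {x : A}
    (hx : f * x = x) (hJ : bar A x ≠ 0) : ∃ b, x * b = f := by
  by_contra hcon
  push Not at hcon
  refine hJ (bar_eq_zero.2 (mem_J.2 fun y => ?_))
  let t : CornerRing f hf := ⟨x * y * f, by rw [← mul_assoc, ← mul_assoc, hx],
    by rw [mul_assoc, hf.eq]⟩
  have ht : ¬ IsUnit t := by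
    rintro ⟨v, hv⟩
    refine hcon (y * f * (↑v⁻¹ : CornerRing f hf).1) ?_
    have h1 : t * (↑v⁻¹ : CornerRing f hf) = 1 := by rw [← hv]; simp
    have h2 : x * y * f * (↑v⁻¹ : CornerRing f hf).1 = f := congrArg Subtype.val h1
    refine Eq.trans ?_ h2
    exact (by intro c; simp only [mul_assoc] : ∀ c : A, x * (y * f * c) = x * y * f * c) _
  have ht' : IsUnit (1 + t) := by
    have := IsLocalRing.isUnit_or_isUnit_of_add_one (a := 1 + t) (b := -t) (by abel)
    rcases this with h | h
    · exact h
    · exact absurd (by simpa using h.neg) ht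
  obtain ⟨v, hv⟩ := ht'
  have h1 : (↑v⁻¹ : CornerRing f hf) * (1 + t) = 1 := by rw [← hv]; simp
  generalize (↑v⁻¹ : CornerRing f hf) = c at h1
  have h2 : c.1 * (f + x * y * f) = f := congrArg Subtype.val h1
  refine ⟨1 - y * c.1 * x, ?_⟩
  have h3 : y * c.1 * x + y * c.1 * x * (y * x) = y * x := by
    calc y * c.1 * x + y * c.1 * x * (y * x)
        = y * (c.1 * (f + x * y * f)) * x := by
          simp only [mul_add, add_mul, mul_assoc, hx]
      _ = y * x := by rw [h2, mul_assoc, hx]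
  calc (1 - y * c.1 * x) * (1 + y * x)
      = 1 + y * x - (y * c.1 * x + y * c.1 * x * (y * x)) := by noncomm_ring
    _ = 1 := by rw [h3]; abel

lemma prim_eq {g k : A} (hg : IsPrimitiveIdempotent g) (hk : k * k = k) (h1 : g * k = k)
    (h2 : k * g = k) (h0 : k ≠ 0) : k = g := by
  obtain ⟨hgg, hg0, hd⟩ := hg
  have hgg : g * g = g := hgg
  have := hd k (g - k) hk (by
    show (g - k) * (g - k) = g - k
    rw [sub_mul, mul_sub, mul_sub, hgg, hk, h1, h2]; abel)
    (by rw [mul_sub, h2, hk, sub_self]) (by rw [sub_mul, h1, hk, sub_self]) (by abel)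
  rcases this with h | h
  · exact absurd h h0
  · exact (sub_eq_zero.1 h).symm

lemma prim_gen (hsemi : IsSemiperfectRing A) {g : A} (hg : IsPrimitiveIdempotent g) {x : A}
    (hx : g * x = x) (hJ : bar A x ≠ 0) : ∃ b, x * b = g := by
  obtain ⟨n, f, hf, ho, hs, hl⟩ := hsemi
  have : ∃ i, bar A (f i * x) ≠ 0 := by
    by_contra hcon
    push Not at hcon
    apply hJ
    rw [← one_mul x, ← hs, Finset.sum_mul, map_sum]
    exact Finset.sum_eq_zero fun i _ => hcon i
  obtain ⟨i, hi⟩ := this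
  have hfi : f i * f i = f i := hf i
  obtain ⟨b, hb⟩ := local_gen (hl i) (x := f i * x) (by rw [← mul_assoc, hfi]) hi
  have hfi0 : f i ≠ 0 := by
    have := (hl i).toNontrivial
    intro h0
    exact one_ne_zero (α := CornerRing (f i) (hf i)) (Subtype.ext h0)
  set h := x * b * f i with hh
  have hhi : h * h = h := by
    calc h * h = x * b * (f i * x * b) * f i := by rw [hh]; simp only [mul_assoc]
      _ = h := by rw [hb, mul_assoc (x * b), hfi]
  have hgh : g * h = h := by rw [hh, ← mul_assoc, ← mul_assoc, hx]
  have hk : (h * g) = g := by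
    refine prim_eq hg ?_ ?_ ?_ ?_
    · calc h * g * (h * g) = h * (g * h) * g := by simp only [mul_assoc]
        _ = h * g := by rw [hgh, hhi]
    · rw [← mul_assoc, hgh]
    · rw [mul_assoc, hg.1.eq]
    · intro h0
      have : h = 0 := by rw [← hhi]; nth_rw 2 [← hgh]; rw [← mul_assoc, h0, zero_mul]
      apply hfi0
      calc f i = f i * f i := hfi.symm
        _ = (f i * x * b) * f i := by rw [hb]
        _ = f i * h := by rw [hh]; simp only [mul_assoc]
        _ = 0 := by rw [this, mul_zero]
  exact ⟨b * f i * g, by rw [← mul_assoc, ← mul_assoc]; exact hk⟩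

lemma mem_rightIdeal {f x : A} (hf : f * f = f) : x ∈ rightIdeal A f ↔ f * x = x := by
  rw [rightIdeal, Submodule.mem_span_singleton]
  constructor
  · rintro ⟨a, rfl⟩
    show f * (f * a.unop) = f * a.unop
    rw [← mul_assoc, hf]
  · intro h
    exact ⟨MulOpposite.op x, h⟩

/-- left multiplication between right ideals. -/
def lmul {f g b : A} (hf : f * f = f) (hg : g * g = g) (hb : g * b = b) :
    rightIdeal A f →ₗ[Aᵐᵒᵖ] rightIdeal A g where
  toFun x := ⟨b * x.1, (mem_rightIdeal hg).2 (by rw [← mul_assoc, hb])⟩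
  map_add' x y := Subtype.ext (mul_add _ _ _)
  map_smul' r x := Subtype.ext (mul_assoc b x.1 r.unop).symm

lemma basic_zero (hsemi : IsSemiperfectRing A) {f g : A} (hf : IsPrimitiveIdempotent f)
    (hg : IsPrimitiveIdempotent g) (hfg : IsEmpty (rightIdeal A f ≃ₗ[Aᵐᵒᵖ] rightIdeal A g))
    (a : A) : bar A (f * a * g) = 0 := by
  by_contra hJ
  have hff : f * f = f := hf.1
  have hgg : g * g = g := hg.1
  set x := f * a * g with hx
  have hfx : f * x = x := by rw [hx, ← mul_assoc, ← mul_assoc, hff]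
  have hxg : x * g = x := by rw [hx, mul_assoc, hgg]
  obtain ⟨b0, hb0⟩ := prim_gen hsemi hf hfx hJ
  set b := g * b0 * f with hb
  have hxb : x * b = f := by rw [hb, ← mul_assoc, ← mul_assoc, hxg, hb0, hff]
  have hgb : g * b = b := by rw [hb, ← mul_assoc, ← mul_assoc, hgg]
  have hbf : b * f = b := by rw [hb, mul_assoc, hff]
  have hbx : b * x = g := by
    refine prim_eq hg ?_ ?_ ?_ ?_
    · rw [mul_assoc, ← mul_assoc x, hxb, hfx]
    · rw [← mul_assoc, hgb]
    · rw [mul_assoc, hxg]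
    · intro h0
      apply hJ
      rw [← hfx, ← hxb, mul_assoc, h0, mul_zero, map_zero]
  refine hfg.false (LinearEquiv.ofLinearMap (lmul hff hgg hgb) (lmul hgg hff hfx) ?_ ?_)
  · ext y
    show b * (x * y.1) = y.1
    rw [← mul_assoc, hbx, (mem_rightIdeal hgg).1 y.2]
  · ext y
    show x * (b * y.1) = y.1
    rw [← mul_assoc, hxb, (mem_rightIdeal hff).1 y.2]

lemma basic_struct (hsemi : IsSemiperfectRing A) (hbasic : IsBasicRing A) :
    ∃ (n : ℕ) (g : Fin n → A), ∑ i, g i = 1 ∧ ∀ i, g i * g i = g i ∧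
      (∀ a, bar A (g i * a) = bar A (a * g i)) ∧
      ∀ a, bar A (g i * a) ≠ 0 → ∃ b, g i * a * b = g i := by
  obtain ⟨n, g, hp, ho, hs, he⟩ := hbasic
  refine ⟨n, g, hs, fun i => ⟨(hp i).1, fun a => ?_, fun a ha => ?_⟩⟩
  · have h1 : bar A (g i * a) = bar A (g i * a * g i) := by
      conv_lhs => rw [← mul_one (g i * a), ← hs, Finset.mul_sum, map_sum]
      refine Finset.sum_eq_single i (fun j _ hj => ?_) (by simp)
      exact basic_zero hsemi (hp i) (hp j) (he i j hj.symm) a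
    have h2 : bar A (a * g i) = bar A (g i * a * g i) := by
      conv_lhs => rw [← one_mul (a * g i), ← hs, Finset.sum_mul, map_sum]
      rw [Finset.sum_eq_single i (fun j _ hj => ?_) (by simp), mul_assoc]
      rw [← mul_assoc]
      exact basic_zero hsemi (hp j) (hp i) (he j i hj) a
    rw [h1, h2]
  · exact prim_gen hsemi (hp i) (by rw [← mul_assoc, (hp i).1.eq]) ha

lemma bar_sq (hsemi : IsSemiperfectRing A) (hbasic : IsBasicRing A) {x : A}
    (hx : bar A (x * x) = 0) : bar A x = 0 := by
  obtain ⟨n, g, hs, hg⟩ := basic_struct hsemi hbasic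
  rw [← one_mul x, ← hs, Finset.sum_mul, map_sum]
  refine Finset.sum_eq_zero fun i _ => ?_
  by_contra hne
  obtain ⟨hi, hc, hgen⟩ := hg i
  obtain ⟨b, hb⟩ := hgen x hne
  apply hne
  rw [hc, ← hb, mul_assoc, ← mul_assoc x, map_mul, ← hc, ← map_mul]
  have : g i * x * (x * b) = g i * (x * x) * b := by simp only [mul_assoc]
  rw [this, map_mul, map_mul, hx, mul_zero, zero_mul]

lemma idem_central (hsemi : IsSemiperfectRing A) (hbasic : IsBasicRing A) {e : A}
    (he : e * e = e) (a : A) : bar A (e * a) = bar A (a * e) := by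
  have h1 : bar A (e * a * (1 - e)) = 0 := by
    apply bar_sq hsemi hbasic
    have : e * a * (1 - e) * (e * a * (1 - e)) = e * a * ((1 - e) * e) * (a * (1 - e)) := by
      simp only [mul_assoc]
    rw [this, sub_mul, he]; simp
  have h2 : bar A ((1 - e) * a * e) = 0 := by
    apply bar_sq hsemi hbasic
    have : (1 - e) * a * e * ((1 - e) * a * e) = (1 - e) * a * (e * (1 - e)) * (a * e) := by
      simp only [mul_assoc]
    rw [this, mul_sub, he]; simp
  have h3 : bar A (e * a) = bar A (e * a * e) := by
    rw [mul_sub, mul_one, map_sub, sub_eq_zero] at h1; exact h1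
  have h4 : bar A (a * e) = bar A (e * a * e) := by
    rw [sub_mul, sub_mul, one_mul, map_sub, sub_eq_zero] at h2; exact h2
  rw [h3, h4]

end RT
end YT
end
end


section
open CategoryTheory CategoryTheory.Abelian Limits Pretriangulated
open scoped DirectSum ZeroObject
set_option linter.unusedSectionVars false
set_option linter.unusedVariables false

noncomputable section
namespace YT

section SM
universe u
open MulOpposite

variable (A : Type u) [Ring A] (e : A)

/-- the canonical generator of `S_e`. -/
def s0 : SeModule A e :=
  Submodule.Quotient.mk (p := (eRad A e).comap (rightIdeal A e).subtype)
    ⟨e, Submodule.subset_span rfl⟩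

lemma s0_gen (s : SeModule A e) : ∃ a : A, op a • s0 A e = s := by
  obtain ⟨⟨x, hx⟩, rfl⟩ := Submodule.Quotient.mk_surjective
    ((eRad A e).comap (rightIdeal A e).subtype) s
  obtain ⟨a, rfl⟩ := Submodule.mem_span_singleton.1 hx
  exact ⟨a.unop, rfl⟩

variable {A} in
lemma eRad_bar {x : A} (hx : x ∈ eRad A e) : bar A x = 0 := by
  refine Submodule.span_induction ?_ ?_ ?_ ?_ hx
  · rintro _ ⟨j, hj, rfl⟩
    show bar A (e * j) = 0
    rw [map_mul, bar_eq_zero.2 (mem_rad.1 hj), mul_zero]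
  · exact map_zero _
  · intro x y _ _ hx hy
    rw [map_add, hx, hy, add_zero]
  · intro a x _ hx
    show bar A (x * a.unop) = 0
    rw [map_mul, hx, zero_mul]

variable {e} in
lemma s0_zero (he : e * e = e) (a : A) : op a • s0 A e = 0 ↔ bar A (e * a) = 0 := by
  have : op a • s0 A e = Submodule.Quotient.mk (p := (eRad A e).comap (rightIdeal A e).subtype)
    (op a • ⟨e, Submodule.subset_span rfl⟩) := rfl
  rw [this]
  refine (Submodule.Quotient.mk_eq_zero _).trans ?_
  show e * a ∈ eRad A e ↔ _
  constructor
  · exact eRad_bar e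
  · intro h
    refine Submodule.subset_span ⟨e * a, mem_rad.2 (bar_eq_zero.1 h), ?_⟩
    show e * (e * a) = e * a
    rw [← mul_assoc, he]

variable {A e}

lemma exists_lift {R T S : Type*} [Ring R] [AddCommGroup T] [Module R T] [AddCommGroup S]
    [Module R S] (t : T) (ht : ∀ x : T, ∃ r : R, r • t = x) (s : S)
    (h : ∀ r : R, r • t = 0 → r • s = 0) : ∃ f : T →ₗ[R] S, f t = s := by
  choose r hr using ht
  have key : ∀ (a b : R), a • t = b • t → a • s = b • s := fun a b hab => by
    rw [← sub_eq_zero, ← sub_smul]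
    apply h
    rw [sub_smul, hab, sub_self]
  refine ⟨{ toFun := fun x => r x • s, map_add' := ?_, map_smul' := ?_ }, ?_⟩
  · intro x y
    rw [← add_smul]
    apply key
    rw [add_smul, hr, hr, hr]
  · intro a x
    rw [RingHom.id_apply, smul_smul]
    apply key
    rw [mul_smul, hr, hr]
  · show r t • s = s
    conv_rhs => rw [← one_smul R s]
    apply key
    rw [hr, one_smul]

lemma s0_end (he : e * e = e) (hc : ∀ a, bar A (e * a) = bar A (a * e)) (b : A) :
    ∃ f : SeModule A e →ₗ[Aᵐᵒᵖ] SeModule A e, f (s0 A e) = op b • s0 A e := by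
  refine exists_lift (s0 A e) (fun x => ?_) _ ?_
  · obtain ⟨a, rfl⟩ := s0_gen A e x; exact ⟨op a, rfl⟩
  · intro r hr
    have hr' := (s0_zero A he r.unop).1 hr
    rw [smul_smul]
    refine (s0_zero A he (b * r.unop)).2 ?_
    rw [← mul_assoc, map_mul, hc, ← map_mul, mul_assoc, map_mul, hr', mul_zero]

lemma S_smul (he : e * e = e) (hc : ∀ a, bar A (e * a) = bar A (a * e)) (s : SeModule A e) :
    op (1 - e) • s = 0 := by
  obtain ⟨a, rfl⟩ := s0_gen A e s
  rw [smul_smul]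
  refine (s0_zero A he (a * (1 - e))).2 ?_
  rw [← mul_assoc, map_mul, hc, ← map_mul, mul_assoc, mul_sub, he, mul_one, sub_self, mul_zero,
    map_zero]

/-- a simple module killed by `1 - e` maps to `S_e`. -/
lemma simple_map (hsemi : IsSemiperfectRing A) (hbasic : IsBasicRing A) (he : e * e = e)
    {T : Type*} [AddCommGroup T] [Module Aᵐᵒᵖ T] [IsSimpleModule Aᵐᵒᵖ T]
    (h1 : ∀ t : T, op (1 - e) • t = 0) : ∃ f : T →ₗ[Aᵐᵒᵖ] SeModule A e, f ≠ 0 := by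
  have hgen : ∀ t : T, t ≠ 0 → ∀ x : T, ∃ r : Aᵐᵒᵖ, r • t = x := fun t ht x => by
    obtain ⟨r, hr⟩ := IsSimpleModule.toSpanSingleton_surjective Aᵐᵒᵖ ht x
    exact ⟨r, hr⟩
  have hJ : ∀ (j : A), bar A j = 0 → ∀ t : T, op j • t = 0 := by
    intro j hj t
    by_contra hne
    obtain ⟨r, hr⟩ := hgen _ hne t
    have hu := unit_of_bar (x := - (j * r.unop)) (by rw [map_neg, map_mul, hj, zero_mul, neg_zero])
    have hz : op (1 + - (j * r.unop)) • t = 0 := by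
      rw [MulOpposite.op_add, MulOpposite.op_neg, op_mul, op_unop, add_smul, neg_smul, mul_smul, hr, op_one, one_smul,
        add_neg_cancel]
    have : t = 0 := by
      obtain ⟨v, hv⟩ := hu
      rw [← hv] at hz
      have := congrArg (fun x => op (↑v⁻¹ : A) • x) hz
      simpa [smul_smul, ← op_mul] using this
    rw [this, smul_zero] at hne
    exact hne rfl
  have hJ' : ∀ (a b : A), bar A a = bar A b → ∀ t : T, op a • t = op b • t := by
    intro a b hab t
    rw [← sub_eq_zero, ← sub_smul, ← MulOpposite.op_sub]
    exact hJ _ (by rw [map_sub, hab, sub_self]) t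
  obtain ⟨n, g, hs, hg⟩ := basic_struct hsemi hbasic
  have hT : Nontrivial T := IsSimpleModule.nontrivial Aᵐᵒᵖ T
  obtain ⟨t, ht⟩ := exists_ne (0 : T)
  have : ∃ i, op (g i) • t ≠ 0 := by
    by_contra hcon
    push Not at hcon
    apply ht
    rw [← one_smul Aᵐᵒᵖ t, ← op_one, ← hs, Finset.op_sum, Finset.sum_smul]
    exact Finset.sum_eq_zero fun i _ => hcon i
  obtain ⟨i, hi⟩ := this
  obtain ⟨hgg, hgc, hgb⟩ := hg i
  have hlift := exists_lift (op (g i) • t) (hgen _ hi) (op (g i) • s0 A e) (by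
    intro r hr
    rw [smul_smul] at hr ⊢
    have hr' : op (g i * r.unop) • t = 0 := hr
    refine (s0_zero A he (g i * r.unop)).2 ?_
    rw [map_mul]
    by_cases hz : bar A (g i * r.unop) = 0
    · rw [hz, mul_zero]
    · exfalso
      obtain ⟨b, hb⟩ := hgb _ hz
      apply hi
      rw [← hb, op_mul, mul_smul, hr', smul_zero])
  obtain ⟨f, hf⟩ := hlift
  refine ⟨f, ?_⟩
  rintro rfl
  rw [LinearMap.zero_apply] at hf
  have h2 := (s0_zero A he (g i)).1 hf.symm
  apply hi
  have h3 : op (e * g i) • t = 0 := hJ _ h2 t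
  have h4 : t = op e • t := by
    have := h1 t
    rw [MulOpposite.op_sub, sub_smul, op_one, one_smul, sub_eq_zero] at this
    exact this
  rw [op_mul, mul_smul, ← h4] at h3
  exact h3

lemma span_eq_top (hsemi : IsSemiperfectRing A) (hbasic : IsBasicRing A) (he : e * e = e)
    {Z : Type*} [AddCommGroup Z] [Module Aᵐᵒᵖ Z] [IsNoetherian Aᵐᵒᵖ Z]
    (h : ∀ f : Z →ₗ[Aᵐᵒᵖ] SeModule A e, f = 0) :
    Submodule.span Aᵐᵒᵖ (Set.range fun z : Z => op (1 - e) • z) = ⊤ := by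
  by_contra hne
  obtain ⟨M, hM, hle⟩ := (eq_top_or_exists_le_coatom _).resolve_left hne
  have : IsSimpleModule Aᵐᵒᵖ (Z ⧸ M) := isSimpleModule_iff_isCoatom.2 hM
  obtain ⟨f, hf⟩ := simple_map (T := Z ⧸ M) hsemi hbasic he (by
    intro t
    obtain ⟨z, rfl⟩ := Submodule.Quotient.mk_surjective _ t
    rw [← Submodule.Quotient.mk_smul, Submodule.Quotient.mk_eq_zero]
    exact hle (Submodule.subset_span ⟨z, rfl⟩))
  apply hf
  have := h (f ∘ₗ M.mkQ)
  exact LinearMap.ext fun x => by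
    obtain ⟨z, rfl⟩ := Submodule.Quotient.mk_surjective _ x
    exact LinearMap.congr_fun this z

end SM

section Noe
universe u
open MulOpposite

/-- Noetherian modules. -/
def noe (R : Type u) [Ring R] : ObjectProperty (ModuleCat.{u} R) := fun M => IsNoetherian R M

instance (R : Type u) [Ring R] : (noe R).IsSerreClass where
  exists_zero := ⟨.of R PUnit, ModuleCat.isZero_of_subsingleton _,
    show IsNoetherian R PUnit.{u+1} from inferInstance⟩
  prop_of_mono {M N} f hf hN := by
    rw [ModuleCat.mono_iff_injective] at hf
    have : IsNoetherian R N := hN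
    exact isNoetherian_of_injective f.hom hf
  prop_of_epi {M N} f hf hM := by
    rw [ModuleCat.epi_iff_surjective] at hf
    have : IsNoetherian R M := hM
    exact isNoetherian_of_surjective f.hom (LinearMap.range_eq_top.2 hf)
  prop_X₂_of_shortExact {S} hS h₁ h₃ := by
    have : IsNoetherian R S.X₁ := h₁
    have : IsNoetherian R S.X₃ := h₃
    exact isNoetherian_of_range_eq_ker S.f.hom S.g.hom
      ((ShortComplex.moduleCat_exact_iff_range_eq_ker S).1 hS.exact)

variable {A : Type} [Ring A] {e : A}

lemma noeth_RS [IsNoetherianRing A] (he : e * e = e) (hc : ∀ a, bar A (e * a) = bar A (a * e)) :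
    IsNoetherian (End (Se A e)) (ModuleCat.of Aᵐᵒᵖ Aᵐᵒᵖ ⟶ Se A e) := by
  choose l hl using s0_end he hc
  refine noeth_of_surj (R := A) (M := A)
    (φ := { toFun := fun b => ModuleCat.ofHom (LinearMap.toSpanSingleton Aᵐᵒᵖ (SeModule A e)
              (op b • s0 A e))
            map_zero' := ?_, map_add' := ?_ })
    (σ := fun a => (ModuleCat.ofHom (l a) : Se A e ⟶ Se A e)) ?_ ?_
  · refine ModuleCat.hom_ext (LinearMap.ext fun r => ?_)
    show r • op (0 : A) • s0 A e = 0
    simp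
  · intro a b
    refine ModuleCat.hom_ext (LinearMap.ext fun r => ?_)
    show r • op (a + b) • s0 A e = r • op a • s0 A e + r • op b • s0 A e
    rw [MulOpposite.op_add, add_smul, smul_add]
  · intro a b
    refine ModuleCat.hom_ext (LinearMap.ext fun r => ?_)
    show r • op (a * b) • s0 A e = l a (r • op b • s0 A e)
    rw [map_smul, map_smul, hl, smul_smul (op b), ← op_mul]
  · intro f
    obtain ⟨a, ha⟩ := s0_gen A e (f.hom (1 : Aᵐᵒᵖ))
    refine ⟨a, ModuleCat.hom_ext (LinearMap.ext fun r => ?_)⟩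
    show r • op a • s0 A e = f.hom r
    rw [ha]
    conv_rhs => rw [← mul_one r, ← smul_eq_mul]
    exact (f.hom.map_smul r (1 : Aᵐᵒᵖ)).symm

lemma noeth_pi {R : Type} [Ring R] (S : ModuleCat.{0} R) (k : ℕ)
    [IsNoetherian (End S) (ModuleCat.of R R ⟶ S)] :
    IsNoetherian (End S) (ModuleCat.of R (Fin k → R) ⟶ S) := by
  let ι : ∀ i : Fin k, ModuleCat.of R R ⟶ ModuleCat.of R (Fin k → R) := fun i =>
    ModuleCat.ofHom (LinearMap.single R (fun _ => R) i)
  let f : (ModuleCat.of R (Fin k → R) ⟶ S) →ₗ[End S] (Fin k → (ModuleCat.of R R ⟶ S)) :=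
    { toFun := fun h i => ι i ≫ h
      map_add' := fun a b => by ext1 i; exact Preadditive.comp_add _ _ _ _ _ _
      map_smul' := fun r h => by ext1 i; exact (Category.assoc _ _ _).symm }
  refine isNoetherian_of_injective f ?_
  intro a b hab
  refine ModuleCat.hom_ext (LinearMap.pi_ext' fun i => ?_)
  exact congrArg ModuleCat.Hom.hom (congrFun hab i)

lemma hcov_S (hN : IsTwoSidedNoetherian A) (he : e * e = e)
    (hc : ∀ a, bar A (e * a) = bar A (a * e)) (Z : ModuleCat.{0} Aᵐᵒᵖ) (hZ : noe Aᵐᵒᵖ Z) :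
    ∃ (Q : ModuleCat.{0} Aᵐᵒᵖ) (q : Q ⟶ Z), Projective Q ∧ noe Aᵐᵒᵖ Q ∧ Epi q ∧
      IsNoetherian (End (Se A e)) (Q ⟶ Se A e) := by
  have := hN.1
  have := hN.2
  have hZ : IsNoetherian Aᵐᵒᵖ Z := hZ
  obtain ⟨k, f, hf⟩ := Module.Finite.exists_fin' Aᵐᵒᵖ Z
  refine ⟨ModuleCat.of Aᵐᵒᵖ (Fin k → Aᵐᵒᵖ), ModuleCat.ofHom f, ?_, ?_, ?_, ?_⟩
  · exact (IsProjective.iff_projective (R := Aᵐᵒᵖ) (Fin k → Aᵐᵒᵖ)).1 inferInstance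
  · show IsNoetherian Aᵐᵒᵖ (Fin k → Aᵐᵒᵖ)
    infer_instance
  · rw [ModuleCat.epi_iff_surjective]; exact hf
  · have := noeth_RS he hc
    exact noeth_pi (Se A e) k

lemma noe_S (hN : IsTwoSidedNoetherian A) : noe Aᵐᵒᵖ (Se A e) := by
  have := hN.2
  refine isNoetherian_of_surjective (LinearMap.toSpanSingleton Aᵐᵒᵖ (SeModule A e) (s0 A e))
    (LinearMap.range_eq_top.2 ?_)
  intro x
  obtain ⟨a, rfl⟩ := s0_gen A e x
  exact ⟨op a, rfl⟩

end Noe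
end YT
end
end


section
open CategoryTheory CategoryTheory.Abelian Limits Pretriangulated
open scoped DirectSum ZeroObject
set_option linter.unusedSectionVars false
set_option linter.unusedVariables false

noncomputable section
namespace YT

section CF
universe u
open MulOpposite

variable {A : Type u} [Ring A] (f : A) (hf : IsIdempotentElem f)

/-- the `f`-part of a right module. -/
def Cor (M : Type*) [AddCommGroup M] [Module Aᵐᵒᵖ M] : AddSubgroup M where
  carrier := {m | op f • m = m}
  add_mem' {a b} ha hb := by
    show op f • (a + b) = a + b
    rw [smul_add]; exact congrArg₂ _ ha hb
  zero_mem' := smul_zero _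
  neg_mem' {a} ha := by
    show op f • (-a) = -a
    rw [smul_neg]; exact congrArg _ ha

/-- the `f`-part as a type, as module over the corner ring. -/
def CorT (hf : IsIdempotentElem f) (M : Type*) [AddCommGroup M] [Module Aᵐᵒᵖ M] : Type _ := Cor f M

instance (M : Type*) [AddCommGroup M] [Module Aᵐᵒᵖ M] : AddCommGroup (CorT f hf M) :=
  inferInstanceAs (AddCommGroup (Cor f M))

variable {f}

lemma cor_mem {M : Type*} [AddCommGroup M] [Module Aᵐᵒᵖ M] (x : CorT f hf M) :
    op f • x.1 = x.1 := x.2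

instance (M : Type*) [AddCommGroup M] [Module Aᵐᵒᵖ M] :
    Module (CornerRing f hf)ᵐᵒᵖ (CorT f hf M) where
  smul r m := ⟨op r.unop.1 • m.1, by
    show op f • op r.unop.1 • m.1 = op r.unop.1 • m.1
    rw [smul_smul, ← op_mul, r.unop.2.2]⟩
  one_smul m := Subtype.ext m.2
  mul_smul r s m := Subtype.ext (by
    show op (s.unop.1 * r.unop.1) • m.1 = op r.unop.1 • op s.unop.1 • m.1
    rw [op_mul, mul_smul])
  smul_zero r := Subtype.ext (smul_zero _)
  smul_add r m n := Subtype.ext (smul_add _ _ _)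
  add_smul r s m := Subtype.ext (by
    show op (r.unop.1 + s.unop.1) • m.1 = op r.unop.1 • m.1 + op s.unop.1 • m.1
    rw [MulOpposite.op_add, add_smul])
  zero_smul m := Subtype.ext (by
    show op (0 : A) • m.1 = 0
    rw [MulOpposite.op_zero, zero_smul])

lemma corT_smul {M : Type*} [AddCommGroup M] [Module Aᵐᵒᵖ M] (r : (CornerRing f hf)ᵐᵒᵖ)
    (m : CorT f hf M) : (r • m).1 = op r.unop.1 • m.1 := rfl

/-- restriction of a linear map to the corner -/
def corMap {M N : Type*} [AddCommGroup M] [Module Aᵐᵒᵖ M] [AddCommGroup N] [Module Aᵐᵒᵖ N]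
    (g : M →ₗ[Aᵐᵒᵖ] N) : CorT f hf M →ₗ[(CornerRing f hf)ᵐᵒᵖ] CorT f hf N where
  toFun m := ⟨g m.1, by
    show op f • g m.1 = g m.1
    rw [← map_smul, cor_mem]⟩
  map_add' a b := Subtype.ext (g.map_add a.1 b.1)
  map_smul' r m := Subtype.ext (g.map_smul _ _)

lemma corMap_apply {M N : Type*} [AddCommGroup M] [Module Aᵐᵒᵖ M] [AddCommGroup N] [Module Aᵐᵒᵖ N]
    (g : M →ₗ[Aᵐᵒᵖ] N) (m : CorT f hf M) : (corMap hf g m).1 = g m.1 := rfl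

end CF

section CF0
open MulOpposite
variable {A : Type} [Ring A] {f : A} (hf : IsIdempotentElem f)

/-- the corner functor. -/
def corF : ModuleCat.{0} Aᵐᵒᵖ ⥤ ModuleCat.{0} (CornerRing f hf)ᵐᵒᵖ where
  obj M := ModuleCat.of _ (CorT f hf M)
  map g := ModuleCat.ofHom (corMap hf g.hom)
  map_id M := rfl
  map_comp g h := rfl

instance : (corF hf).Additive where
  map_add {M N} {g h} := rfl

lemma corF_exact (S : ShortComplex (ModuleCat.{0} Aᵐᵒᵖ)) (hS : S.Exact) :
    (S.map (corF hf)).Exact := by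
  rw [ShortComplex.moduleCat_exact_iff] at hS ⊢
  intro (x : CorT f hf S.X₂) hx
  have hx' : S.g.hom x.1 = 0 := congrArg Subtype.val hx
  obtain ⟨y, hy⟩ := hS x.1 hx'
  have hff : op f * op f = op f := by rw [← op_mul, hf.eq]
  refine ⟨(⟨op f • y, by show op f • op f • y = op f • y; rw [smul_smul, hff]⟩ :
    CorT f hf S.X₁), Subtype.ext ?_⟩
  show S.f.hom (op f • y) = x.1
  have hy' : S.f.hom y = x.1 := hy
  rw [map_smul, hy', cor_mem]

lemma corF_pres : PreservesFiniteLimits (corF hf) ∧ PreservesFiniteColimits (corF hf) :=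
  ((corF hf).exact_tfae.out 1 3).1 (corF_exact hf)

instance : PreservesFiniteLimits (corF hf) := (corF_pres hf).1
instance : PreservesFiniteColimits (corF hf) := (corF_pres hf).2

/-- direct sums commute with corners. -/
def corFinsupp (J : Type*) (M : Type*) [AddCommGroup M] [Module Aᵐᵒᵖ M] :
    CorT f hf (J →₀ M) ≃ₗ[(CornerRing f hf)ᵐᵒᵖ] (J →₀ CorT f hf M) :=
  LinearEquiv.symm
  { toFun := fun x => ⟨x.mapRange Subtype.val rfl, by
      show op f • x.mapRange Subtype.val rfl = x.mapRange Subtype.val rfl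
      ext j
      exact cor_mem hf (x j)⟩
    map_add' := fun x y => Subtype.ext (by
      ext j
      rfl)
    map_smul' := fun r x => Subtype.ext (by
      ext j
      rfl)
    invFun := fun x =>
      { support := x.1.support
        toFun := fun j => ⟨x.1 j, by
          show op f • x.1 j = x.1 j
          exact DFunLike.congr_fun (cor_mem hf x) j⟩
        mem_support_toFun := fun j => by
          rw [Finsupp.mem_support_iff]
          exact not_congr ⟨fun h => Subtype.ext h, fun h => congrArg Subtype.val h⟩ }
    left_inv := fun x => by
      ext j
      rfl
    right_inv := fun x => Subtype.ext (by
      ext j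
      rfl) }

/-- the coinduced module -/
def Coind (hf : IsIdempotentElem f) (N : Type*) [AddCommGroup N]
    [Module (CornerRing f hf)ᵐᵒᵖ N] : AddSubgroup (A →+ N) where
  carrier := {φ | ∀ (a : A) (γ : CornerRing f hf), φ (a * γ.1) = op γ • φ a}
  add_mem' {φ ψ} hφ hψ := fun a γ => by
    show φ _ + ψ _ = op γ • (φ a + ψ a)
    rw [hφ, hψ, smul_add]
  zero_mem' := fun a γ => (smul_zero _).symm
  neg_mem' {φ} hφ := fun a γ => by
    show - φ _ = op γ • (- φ a)
    rw [hφ, smul_neg]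

/-- the coinduced module as a type -/
def CoindT (hf : IsIdempotentElem f) (N : Type*) [AddCommGroup N]
    [Module (CornerRing f hf)ᵐᵒᵖ N] : Type _ := Coind hf N

instance (N : Type*) [AddCommGroup N] [Module (CornerRing f hf)ᵐᵒᵖ N] :
    AddCommGroup (CoindT hf N) := inferInstanceAs (AddCommGroup (Coind hf N))

instance (N : Type*) [AddCommGroup N] [Module (CornerRing f hf)ᵐᵒᵖ N] :
    Module Aᵐᵒᵖ (CoindT hf N) where
  smul a φ := ⟨φ.1.comp (AddMonoidHom.mulLeft a.unop), fun b γ => by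
    show φ.1 (a.unop * (b * γ.1)) = op γ • φ.1 (a.unop * b)
    rw [← mul_assoc]; exact φ.2 _ _⟩
  one_smul φ := Subtype.ext (AddMonoidHom.ext fun x => by
    show φ.1 (1 * x) = φ.1 x
    rw [one_mul])
  mul_smul a b φ := Subtype.ext (AddMonoidHom.ext fun x => by
    show φ.1 ((b.unop * a.unop) * x) = φ.1 (b.unop * (a.unop * x))
    rw [mul_assoc])
  smul_zero a := Subtype.ext (AddMonoidHom.ext fun x => rfl)
  smul_add a φ ψ := Subtype.ext (AddMonoidHom.ext fun x => rfl)
  add_smul a b φ := Subtype.ext (AddMonoidHom.ext fun x => by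
    show φ.1 ((a.unop + b.unop) * x) = φ.1 (a.unop * x) + φ.1 (b.unop * x)
    rw [add_mul, map_add])
  zero_smul φ := Subtype.ext (AddMonoidHom.ext fun x => by
    show φ.1 (0 * x) = 0
    rw [zero_mul, map_zero])

/-- compression of an element to the corner. -/
def comp' (x : A) : CornerRing f hf := ⟨f * x * f, by
  rw [← mul_assoc, ← mul_assoc, hf.eq], by rw [mul_assoc, hf.eq]⟩

/-- evaluation at `f` is an isomorphism. -/
def coindEquiv (N : Type*) [AddCommGroup N] [Module (CornerRing f hf)ᵐᵒᵖ N] :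
    CorT f hf (CoindT hf N) ≃ₗ[(CornerRing f hf)ᵐᵒᵖ] N where
  toFun φ := φ.1.1 f
  map_add' φ ψ := rfl
  map_smul' r φ := by
    show φ.1.1 (r.unop.1 * f) = r • φ.1.1 f
    rw [r.unop.2.2]
    conv_lhs => rw [← r.unop.2.1]
    exact φ.1.2 f r.unop
  invFun n := ⟨⟨
    { toFun := fun x => op (comp' hf x) • n
      map_zero' := by
        have : comp' hf (0 : A) = 0 := Subtype.ext (by show f * 0 * f = 0; simp)
        rw [this, MulOpposite.op_zero, zero_smul]
      map_add' := fun x y => by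
        have : comp' hf (x + y) = comp' hf x + comp' hf y :=
          Subtype.ext (by show f * (x + y) * f = f * x * f + f * y * f; rw [mul_add, add_mul])
        rw [this, MulOpposite.op_add, add_smul] }, fun a γ => by
      show op (comp' hf (a * γ.1)) • n = op γ • op (comp' hf a) • n
      rw [smul_smul, ← op_mul]
      congr 2
      refine Subtype.ext ?_
      show f * (a * γ.1) * f = f * a * f * γ.1
      have h1 := γ.2.1
      have h2 := γ.2.2
      rw [mul_assoc (f * a), h1, mul_assoc, mul_assoc, h2, mul_assoc]⟩, by
    refine Subtype.ext (AddMonoidHom.ext fun x => ?_)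
    show op (comp' hf (f * x)) • n = op (comp' hf x) • n
    congr 2
    refine Subtype.ext ?_
    show f * (f * x) * f = f * x * f
    rw [← mul_assoc, hf.eq]⟩
  left_inv φ := by
    refine Subtype.ext (Subtype.ext (AddMonoidHom.ext fun x => ?_))
    show op (comp' hf x) • φ.1.1 f = φ.1.1 x
    have h1 : φ.1.1 (f * (comp' hf x).1) = op (comp' hf x) • φ.1.1 f := φ.1.2 f (comp' hf x)
    have h2 : φ.1.1 (x * f) = φ.1.1 x := (φ.1.2 x 1).trans (by rw [op_one, one_smul])
    have h3 : φ.1.1 (f * (x * f)) = φ.1.1 (x * f) :=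
      DFunLike.congr_fun (congrArg Subtype.val (cor_mem hf φ)) (x * f)
    rw [← h1, ← h2, ← h3]
    congr 1
    show f * (f * x * f) = _
    rw [← mul_assoc, ← mul_assoc, hf.eq, mul_assoc]
  right_inv n := by
    show op (comp' hf f) • n = n
    have : comp' hf f = 1 := Subtype.ext (by show f * f * f = f; rw [hf.eq, hf.eq])
    rw [this, op_one, one_smul]

end CF0
end YT
end
end


section
open CategoryTheory CategoryTheory.Abelian Limits Pretriangulated
open scoped DirectSum ZeroObject
set_option linter.unusedSectionVars false
set_option linter.unusedVariables false

noncomputable section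
namespace YT

section H2
open MulOpposite
variable {A : Type} [Ring A]

lemma proj_finsupp {R : Type*} [Ring R] (J M : Type*) [AddCommGroup M] [Module R M]
    [Module.Projective R M] : Module.Projective R (J →₀ M) := by
  classical
  exact Module.Projective.of_equiv (finsuppLequivDFinsupp (ι := J) (M := M) R).symm

/-- the generator of `fA` -/
def fgen (f : A) : rightIdeal A f := ⟨f, Submodule.subset_span rfl⟩

lemma fgen_gen {f : A} (hf : f * f = f) (x : rightIdeal A f) : op x.1 • fgen f = x :=
  Subtype.ext ((mem_rightIdeal hf).1 x.2)

/-- inclusion of `fA` in `Aᵐᵒᵖ` -/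
def fincl (f : A) : rightIdeal A f →ₗ[Aᵐᵒᵖ] Aᵐᵒᵖ where
  toFun x := op x.1
  map_add' x y := rfl
  map_smul' r x := rfl

lemma proj_rightIdeal {f : A} (hf : f * f = f) : Module.Projective Aᵐᵒᵖ (rightIdeal A f) :=
  Module.Projective.of_split (fincl f) (LinearMap.toSpanSingleton Aᵐᵒᵖ _ (fgen f))
    (LinearMap.ext fun x => fgen_gen hf x)

/-- the corner of `fA` is the corner ring. -/
def corRight {f : A} (hf : IsIdempotentElem f) :
    (CornerRing f hf)ᵐᵒᵖ ≃ₗ[(CornerRing f hf)ᵐᵒᵖ] CorT f hf (rightIdeal A f) where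
  toFun r := ⟨⟨r.unop.1, (mem_rightIdeal hf.eq).2 r.unop.2.1⟩, Subtype.ext r.unop.2.2⟩
  map_add' r s := rfl
  map_smul' r s := rfl
  invFun x := op ⟨x.1.1, (mem_rightIdeal hf.eq).1 x.1.2, congrArg Subtype.val (cor_mem hf x)⟩
  left_inv r := rfl
  right_inv x := rfl

lemma h2_S {e : A} (hN : IsTwoSidedNoetherian A)
    (hsemi : IsSemiperfectRing A) (hbasic : IsBasicRing A) (he : IsIdempotentElem e)
    (hc : ∀ a, bar A (e * a) = bar A (a * e)) (Z : ModuleCat.{0} Aᵐᵒᵖ) (hZ : noe Aᵐᵒᵖ Z)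
    (h : ∀ f : Z ⟶ Se A e, f = 0) :
    ∃ (Q : ModuleCat.{0} Aᵐᵒᵖ) (q : Q ⟶ Z), Projective Q ∧ noe Aᵐᵒᵖ Q ∧ Epi q ∧
      (∀ f : Q ⟶ Se A e, f = 0) ∧ Projective ((corF he.one_sub).obj Q) := by
  have := hN.2
  have hZ : IsNoetherian Aᵐᵒᵖ Z := hZ
  have htop := span_eq_top (Z := Z) hsemi hbasic he.eq (fun f => congrArg ModuleCat.Hom.hom
    (h (ModuleCat.ofHom f)))
  have hf := he.one_sub
  have hfg : (Submodule.span Aᵐᵒᵖ (Set.range fun z : Z => op (1 - e) • z)).FG :=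
    IsNoetherian.noetherian _
  obtain ⟨t, ht, hspan⟩ := Submodule.fg_span_iff_fg_span_finset_subset _ |>.1 hfg
  rw [htop] at hspan
  have hpr := proj_rightIdeal hf.eq
  have hno : IsNoetherian Aᵐᵒᵖ (rightIdeal A (1 - e)) :=
    isNoetherian_of_surjective (LinearMap.toSpanSingleton Aᵐᵒᵖ _ (fgen (1 - e)))
    (LinearMap.range_eq_top.2 fun x => ⟨op x.1, fgen_gen hf.eq x⟩)
  let q : (t →₀ rightIdeal A (1 - e)) →ₗ[Aᵐᵒᵖ] Z :=
    Finsupp.lsum ℕ fun z => (LinearMap.toSpanSingleton Aᵐᵒᵖ Z z.1) ∘ₗ fincl (1 - e)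
  refine ⟨ModuleCat.of Aᵐᵒᵖ (t →₀ rightIdeal A (1 - e)), ModuleCat.ofHom q, ?_, ?_, ?_, ?_, ?_⟩
  · exact (IsProjective.iff_projective _).1 (proj_finsupp _ _)
  · show IsNoetherian Aᵐᵒᵖ (t →₀ rightIdeal A (1 - e))
    exact isNoetherian_of_linearEquiv
      (Finsupp.linearEquivFunOnFinite Aᵐᵒᵖ (rightIdeal A (1 - e)) t).symm
  · rw [ModuleCat.epi_iff_surjective]
    show Function.Surjective q
    rw [← LinearMap.range_eq_top, eq_top_iff, hspan, Submodule.span_le]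
    intro z hz
    refine ⟨Finsupp.single ⟨z, hz⟩ (fgen (1 - e)), ?_⟩
    obtain ⟨y, rfl⟩ := ht hz
    simp only [q, Finsupp.lsum_single]
    show op (1 - e) • op (1 - e) • y = op (1 - e) • y
    rw [smul_smul, ← op_mul, hf.eq]
  · intro g
    refine ModuleCat.hom_ext (Finsupp.lhom_ext fun i x => ?_)
    have hx : Finsupp.single i x = op x.1 • op (1 - e) • Finsupp.single i (fgen (1 - e)) := by
      rw [Finsupp.smul_single, Finsupp.smul_single]
      have : op (1 - e) • fgen (1 - e) = fgen (1 - e) := fgen_gen hf.eq (fgen (1 - e))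
      rw [this, fgen_gen hf.eq]
    rw [hx]
    refine (g.hom.map_smul _ _).trans ?_
    rw [g.hom.map_smul]
    have : op (1 - e) • g.hom (Finsupp.single i (fgen (1 - e))) = 0 := S_smul he.eq hc _
    rw [this, smul_zero]; rfl
  · have h1 : Module.Projective (CornerRing (1 - e) hf)ᵐᵒᵖ (CorT (1 - e) hf (rightIdeal A (1 - e))) :=
      Module.Projective.of_equiv (corRight hf)
    have h2 := proj_finsupp (R := (CornerRing (1 - e) hf)ᵐᵒᵖ) t (CorT (1 - e) hf (rightIdeal A (1 - e)))
    exact (IsProjective.iff_projective _).1 (Module.Projective.of_equiv (corFinsupp hf t _).symm)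

lemma zero_S {e : A} (he : IsIdempotentElem e) (hc : ∀ a, bar A (e * a) = bar A (a * e)) :
    IsZero ((corF he.one_sub).obj (Se A e)) := by
  have : Subsingleton (CorT (1 - e) he.one_sub (SeModule A e)) := ⟨fun a b => Subtype.ext (by
    rw [← cor_mem _ a, ← cor_mem _ b, S_smul he.eq hc, S_smul he.eq hc])⟩
  exact @ModuleCat.isZero_of_subsingleton _ _ (ModuleCat.of _ (CorT (1 - e) he.one_sub (SeModule A e))) this

end H2

section PD
variable {R : Type} [Ring R]

variable (R) in
/-- the free module -/
def FreeT (M : Type) : Type := M →₀ R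

instance (M : Type) : AddCommGroup (FreeT R M) := inferInstanceAs (AddCommGroup (M →₀ R))
instance (M : Type) : Module R (FreeT R M) := inferInstanceAs (Module R (M →₀ R))
instance (M : Type) : Module.Projective R (FreeT R M) :=
  inferInstanceAs (Module.Projective R (M →₀ R))

/-- the canonical cover of a module by a free module. -/
def cov (M : Type) [AddCommGroup M] [Module R M] : FreeT R M →ₗ[R] M :=
  Finsupp.linearCombination R (id : M → M)

lemma cov_surj (M : Type) [AddCommGroup M] [Module R M] :
    Function.Surjective (cov (R := R) M) := fun m =>
  ⟨(Finsupp.single m 1 : M →₀ R), by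
    show Finsupp.linearCombination R (id : M → M) (Finsupp.single m 1) = m
    simp⟩

variable (R) in
/-- the kernel of the cover -/
def covK (M : Type) [AddCommGroup M] [Module R M] : Submodule R (FreeT R M) :=
  LinearMap.ker (cov (R := R) M)

lemma covK_mem (M : Type) [AddCommGroup M] [Module R M] (k : covK R M) :
    cov (R := R) M ((covK R M).subtype k) = 0 := k.2

/-- short complex from submodule-type data -/
def scOf {K F M : Type} [AddCommGroup K] [Module R K] [AddCommGroup F] [Module R F]
    [AddCommGroup M] [Module R M] (i : K →ₗ[R] F) (p : F →ₗ[R] M) (h : ∀ k, p (i k) = 0) :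
    ShortComplex (ModuleCat.{0} R) :=
  ShortComplex.mk (ModuleCat.ofHom i) (ModuleCat.ofHom p)
    (ModuleCat.hom_ext (LinearMap.ext h))

lemma scOf_exact {K F M : Type} [AddCommGroup K] [Module R K] [AddCommGroup F] [Module R F]
    [AddCommGroup M] [Module R M] (i : K →ₗ[R] F) (p : F →ₗ[R] M) (h : ∀ k, p (i k) = 0)
    (hi : Function.Injective i) (hp : Function.Surjective p)
    (hx : ∀ x, p x = 0 → ∃ k, i k = x) : (scOf i p h).ShortExact where
  exact := (ShortComplex.moduleCat_exact_iff _).2 hx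
  mono_f := (ModuleCat.mono_iff_injective _).2 hi
  epi_g := (ModuleCat.epi_iff_surjective _).2 hp

lemma cov_exact (M : Type) [AddCommGroup M] [Module R M] :
    (scOf (R := R) (K := covK R M) (F := FreeT R M) (M := M)
      (covK R M).subtype (cov (R := R) M) (covK_mem M)).ShortExact :=
  scOf_exact _ _ _ Subtype.val_injective (cov_surj M) fun x hx => ⟨⟨x, hx⟩, rfl⟩

lemma pd_finsupp (J : Type) (n : ℕ) : ∀ (M : Type) [AddCommGroup M] [Module R M],
    HasProjectiveDimensionLT (ModuleCat.of R M) (n + 1) →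
    HasProjectiveDimensionLT (ModuleCat.of R (J →₀ M)) (n + 1) := by
  induction n with
  | zero =>
    intro M _ _ h
    have h' := (projective_iff_hasProjectiveDimensionLT_one (X := ModuleCat.of R M)).2 h
    have := (IsProjective.iff_projective (R := R) M).2 h'
    exact (projective_iff_hasProjectiveDimensionLT_one (X := ModuleCat.of R (J →₀ M))).1
      ((IsProjective.iff_projective (R := R) (J →₀ M)).1 (proj_finsupp _ _))
  | succ n ih =>
    intro M _ _ h
    have hP : Projective (ModuleCat.of R (FreeT R M)) := (IsProjective.iff_projective _).1 inferInstance
    have hPJ : Projective (ModuleCat.of R (J →₀ (FreeT R M))) :=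
      (IsProjective.iff_projective _).1 (proj_finsupp _ _)
    have hK : HasProjectiveDimensionLT (ModuleCat.of R (covK R M)) (n + 1) :=
      ((cov_exact (R := R) M).hasProjectiveDimensionLT_X₃_iff n hP).1 h
    have hKJ := ih _ hK
    have hex : (scOf (R := R) (K := J →₀ covK R M) (F := J →₀ (FreeT R M)) (M := J →₀ M)
        (Finsupp.mapRange.linearMap (α := J) (covK R M).subtype)
        (Finsupp.mapRange.linearMap (α := J) (cov (R := R) M)) (fun k => by
          ext j; exact covK_mem M (k j))).ShortExact := by
      refine scOf_exact _ _ _ ?_ ?_ ?_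
      · exact Finsupp.mapRange_injective _ (map_zero _) Subtype.val_injective
      · exact Finsupp.mapRange_surjective _ (map_zero _) (cov_surj M)
      · intro x hx
        refine ⟨{ support := x.support
                  toFun := fun j => ⟨x j, DFunLike.congr_fun hx j⟩
                  mem_support_toFun := fun j => ?_ }, ?_⟩
        · rw [Finsupp.mem_support_iff]
          exact not_congr ⟨fun h => Subtype.ext h, fun h => congrArg Subtype.val h⟩
        · ext j
          rfl
    exact (hex.hasProjectiveDimensionLT_X₃_iff n hPJ).2 hKJ

end PD

section Fin
open MulOpposite
variable {A : Type} [Ring A] {f : A} (hf : IsIdempotentElem f)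

lemma pd_corF (n : ℕ)
    (h : HasProjectiveDimensionLT ((corF hf).obj (ModuleCat.of Aᵐᵒᵖ Aᵐᵒᵖ)) (n + 1)) (k : ℕ) :
    ∀ (L : Type) [AddCommGroup L] [Module Aᵐᵒᵖ L],
    HasProjectiveDimensionLT (ModuleCat.of Aᵐᵒᵖ L) (k + 1) →
    HasProjectiveDimensionLT ((corF hf).obj (ModuleCat.of Aᵐᵒᵖ L)) (n + 1 + k) := by
  have hfree : ∀ J : Type, HasProjectiveDimensionLT
      ((corF hf).obj (ModuleCat.of Aᵐᵒᵖ (FreeT Aᵐᵒᵖ J))) (n + 1) := fun J => by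
    have := pd_finsupp (R := (CornerRing f hf)ᵐᵒᵖ) J n (CorT f hf Aᵐᵒᵖ) h
    exact hasProjectiveDimensionLT_of_iso (corFinsupp hf J Aᵐᵒᵖ).symm.toModuleIso (n + 1)
  induction k with
  | zero =>
    intro L _ _ hL
    have hL' := (projective_iff_hasProjectiveDimensionLT_one (X := ModuleCat.of Aᵐᵒᵖ L)).2 hL
    have hepi : Epi (ModuleCat.ofHom (cov (R := Aᵐᵒᵖ) L)) :=
      (ModuleCat.epi_iff_surjective _).2 (cov_surj L)
    have hret : Retract (ModuleCat.of Aᵐᵒᵖ L) (ModuleCat.of Aᵐᵒᵖ (FreeT Aᵐᵒᵖ L)) :=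
      { i := Projective.factorThru (𝟙 _) (ModuleCat.ofHom (cov (R := Aᵐᵒᵖ) L))
        r := ModuleCat.ofHom (cov (R := Aᵐᵒᵖ) L)
        retract := Projective.factorThru_comp _ _ }
    have := hfree L
    exact (hret.map (corF hf)).hasProjectiveDimensionLT (n + 1)
  | succ k ih =>
    intro L _ _ hL
    have hP : Projective (ModuleCat.of Aᵐᵒᵖ (FreeT Aᵐᵒᵖ L)) :=
      (IsProjective.iff_projective _).1 inferInstance
    have hK : HasProjectiveDimensionLT
        (ModuleCat.of Aᵐᵒᵖ (covK Aᵐᵒᵖ L)) (k + 1) :=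
      ((cov_exact (R := Aᵐᵒᵖ) L).hasProjectiveDimensionLT_X₃_iff k hP).1 hL
    have hK' := ih _ hK
    have hF := hfree L
    have hF' := hasProjectiveDimensionLT_of_ge
      ((corF hf).obj (ModuleCat.of Aᵐᵒᵖ (FreeT Aᵐᵒᵖ L))) (n + 1) (n + 1 + k + 1) (by omega)
    exact ((cov_exact (R := Aᵐᵒᵖ) L).map_of_exact (corF hf)).hasProjectiveDimensionLT_X₃
      (n + 1 + k) hK' hF'

end Fin

lemma fgd_iff {R : Type u} [Ring R] : HasFiniteGlobalDimension R ↔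
    ∃ n : ℕ, ∀ M : ModuleCat.{u} Rᵐᵒᵖ, HasProjectiveDimensionLT M (n + 1) := by
  constructor
  · rintro ⟨n, h⟩
    refine ⟨n, fun M => ?_⟩
    rw [hasProjectiveDimensionLT_iff.{u + 1}]
    intro i hi Y x
    have := h M Y i (by omega)
    exact Subsingleton.elim _ _
  · rintro ⟨n, h⟩
    refine ⟨n, fun M N i hi => ?_⟩
    have := h M
    exact HasProjectiveDimensionLT.subsingleton M (n + 1) i (by omega) N

theorem main
    (A : Type) [Ring A] (hNoeth : IsTwoSidedNoetherian A)
    (hsemi : IsSemiperfectRing A) (hbasic : IsBasicRing A)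
    (e : A) (he : IsIdempotentElem e)
    (hA : HasFiniteGlobalDimension A)
    (hYgl : HasFiniteGlobalDimension (YonedaRing A e)) :
    HasFiniteGlobalDimension (CornerRing (1 - e) he.one_sub) := by
  have hc := idem_central hsemi hbasic he.eq
  obtain ⟨d, hd⟩ := fgd_iff.1 hA
  obtain ⟨m, hm⟩ := fgd_iff.1 hYgl
  let _ := HasDerivedCategory.standard (ModuleCat.{0} Aᵐᵒᵖ)
  let _ := HasDerivedCategory.standard (ModuleCat.{0} (CornerRing (1 - e) he.one_sub)ᵐᵒᵖ)
  have hreg : noe Aᵐᵒᵖ (ModuleCat.of Aᵐᵒᵖ Aᵐᵒᵖ) := hNoeth.2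
  obtain ⟨n, hn⟩ := abstract_main (Φ := corF he.one_sub) (P := noe Aᵐᵒᵖ) (S := Se A e) d hd
    (h2_S hNoeth hsemi hbasic he hc) (hcov_S hNoeth he.eq hc) (noe_S hNoeth) (zero_S he hc) m hm
    (ModuleCat.of Aᵐᵒᵖ Aᵐᵒᵖ) hreg
  have hn' := hasProjectiveDimensionLT_of_ge
    ((corF he.one_sub).obj (ModuleCat.of Aᵐᵒᵖ Aᵐᵒᵖ)) n (n + 1) (by omega)
  rw [fgd_iff]
  refine ⟨n + d, fun N => ?_⟩
  have h1 := pd_corF he.one_sub n hn' d (CoindT he.one_sub N) (hd _)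
  have h2 := hasProjectiveDimensionLT_of_iso
    (show (corF he.one_sub).obj (ModuleCat.of Aᵐᵒᵖ (CoindT he.one_sub N)) ≅ N from
      (coindEquiv he.one_sub N).toModuleIso) (n + 1 + d)
  rwa [show n + d + 1 = n + 1 + d by omega]

end YT
end
end

/-- **Proposition.** Let `A` be a Noetherian semiperfect basic ring and `e` an idempotent.
If `A` and the Yoneda ring `Y(e) = Ext_A^*(S_e, S_e)` both have finite global dimension,
then `Γ = (1-e)A(1-e)` has finite global dimension. -/
theorem hasFiniteGlobalDimension_corner_of_yonedaRing
    (A : Type) [Ring A] (hNoeth : IsTwoSidedNoetherian A)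
    (hsemi : IsSemiperfectRing A) (hbasic : IsBasicRing A)
    (e : A) (he : IsIdempotentElem e)
    (hA : HasFiniteGlobalDimension A)
    (hYgl : HasFiniteGlobalDimension (YonedaRing A e)) :
    HasFiniteGlobalDimension (CornerRing (1 - e) he.one_sub) := by
  exact YT.main A hNoeth hsemi hbasic e he hA hYgl
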